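/- (Theorem 3.3) The James–Stein estimator Σ̂₀(T) = T diag(d₁, …, d_p) Tᵀ with d_i = 1/(n+p−2i+1) is minimax under Stein loss: its risk is constant, ∫_{T⁺} [tr(Θ Σ̂₀(T) Θᵀ) − log det(Θ Σ̂₀(T) Θᵀ) − p] f_W(T | Θ) γ(dT) = R₀ for every Θ ∈ T⁺, where R₀ = ∫_{T⁺} [tr(Σ̂₀(T)) − log det(Σ̂₀(T)) − p] f_W(T | I_p) γ(dT); and for every measurable estimator δ : T⁺ → (p×p symmetric positive definite matrices), sup_{Θ ∈ T⁺} ∫_{T⁺} [tr(Θ δ(T) Θᵀ) − log det(Θ δ(T) Θᵀ) − p] f_W(T | Θ) γ(dT) ≥ R₀. -/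

import Mathlib

open MeasureTheory ENNReal Matrix

abbrev LowIdx (p : ℕ) := {q : Fin p × Fin p // q.2 ≤ q.1}
abbrev TriCoords (p : ℕ) := LowIdx p → ℝ

noncomputable def triMat {p : ℕ} (x : TriCoords p) : Matrix (Fin p) (Fin p) ℝ :=
  Matrix.of fun i j => if h : j ≤ i then x ⟨(i, j), h⟩ else 0

def triPos (p : ℕ) : Set (TriCoords p) :=
  {x | ∀ i : Fin p, 0 < x ⟨(i, i), le_rfl⟩}

noncomputable def gammaDens {p : ℕ} (x : TriCoords p) : ℝ≥0∞ :=
  ∏ i : Fin p, ENNReal.ofReal (x ⟨(i, i), le_rfl⟩ ^ (-((i : ℕ) + 1) : ℤ))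

noncomputable def gammaDensR {p : ℕ} (x : TriCoords p) : ℝ :=
  ∏ i : Fin p, x ⟨(i, i), le_rfl⟩ ^ (-((i : ℕ) + 1) : ℤ)

instance matrixMeasurableSpace {p : ℕ} : MeasurableSpace (Matrix (Fin p) (Fin p) ℝ) :=
  inferInstanceAs (MeasurableSpace (Fin p → Fin p → ℝ))

def memTplus {p : ℕ} (A : Matrix (Fin p) (Fin p) ℝ) : Prop :=
  (∀ i j : Fin p, i < j → A i j = 0) ∧ ∀ i : Fin p, 0 < A i i

noncomputable def wishartC (p n : ℕ) : ℝ :=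
  2 ^ ((p : ℝ) * ((n : ℝ) - 2) / 2) * Real.pi ^ ((p : ℝ) * ((p : ℝ) - 1) / 4) *
    ∏ i : Fin p, Real.Gamma (((n : ℝ) - (i : ℕ)) / 2)

noncomputable def wishartDens (p n : ℕ) (Θ T : Matrix (Fin p) (Fin p) ℝ) : ℝ :=
  (Θ * T).det ^ n * Real.exp (-(1 / 2) * ((Θ * T) * (Θ * T)ᵀ).trace) / wishartC p n

/-- Stein's loss `L(ΘΔΘᵀ) = tr(ΘΔΘᵀ) - log det(ΘΔΘᵀ) - p`, as a function of the
matrix `M = ΘΔΘᵀ`. -/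
noncomputable def steinLoss (p : ℕ) (M : Matrix (Fin p) (Fin p) ℝ) : ℝ :=
  M.trace - Real.log M.det - (p : ℝ)

/-- The James–Stein estimator `Σ̂₀(T) = T diag(d₁, …, d_p) Tᵀ`, `d_i = 1/(n+p-2i+1)`. -/
noncomputable def jamesStein (p n : ℕ) (T : Matrix (Fin p) (Fin p) ℝ) :
    Matrix (Fin p) (Fin p) ℝ :=
  T * Matrix.diagonal (fun i : Fin p =>
    ((n : ℝ) + (p : ℝ) - 2 * ((i : ℕ) : ℝ) - 1)⁻¹) * Tᵀ

section Shear

variable {ι : Type*} [Fintype ι] [DecidableEq ι]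

/-- Adding to one coordinate a measurable function of the others preserves volume. -/
lemma measurePreserving_update_add (a : ι) (h : (ι → ℝ) → ℝ) (hm : Measurable h)
    (hind : ∀ y t, h (Function.update y a t) = h y) :
    MeasurePreserving (fun y : ι → ℝ => Function.update y a (y a + h y)) := by
  have hmeas : Measurable (fun y : ι → ℝ => Function.update y a (y a + h y)) := by
    refine measurable_pi_iff.2 fun c => ?_
    by_cases hc : c = a
    · subst hc
      simp only [Function.update_self]
      exact (measurable_pi_apply c).add hm
    · simpa [Function.update_of_ne hc] using measurable_pi_apply c
  refine ⟨hmeas, Measure.ext_of_lintegral _ fun f hf => ?_⟩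
  rw [lintegral_map hf hmeas]
  refine lintegral_eq_of_lmarginal_eq (μ := fun _ : ι => (volume : Measure ℝ)) {a}
    (hf.comp hmeas) hf ?_
  rw [lmarginal_singleton, lmarginal_singleton]
  funext x
  simp only [Function.update_self, Function.update_idem, hind]
  exact lintegral_add_right_eq_self (fun t => f (Function.update x a t)) (h x)

/-- A unipotent triangular map, possibly nonlinear, preserves volume. -/
lemma measurePreserving_add_of_rank (r : ι → ℕ) (h : ι → (ι → ℝ) → ℝ)
    (hm : ∀ c, Measurable (h c))
    (hind : ∀ c y y', (∀ d, r d < r c → y d = y' d) → h c y = h c y') :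
    MeasurePreserving (fun (y : ι → ℝ) c => y c + h c y) := by
  suffices H : ∀ s : Finset ι,
      MeasurePreserving (fun (y : ι → ℝ) c => if c ∈ s then y c + h c y else y c) by
    simpa using H Finset.univ
  intro s
  induction s using Finset.induction_on_min_value r with
  | empty =>
    simp only [Finset.notMem_empty, if_false]
    exact MeasurePreserving.id _
  | insert a s ha hr ih =>
    have h1 := measurePreserving_update_add a (h a) (hm a) fun y t =>
      hind a _ _ fun d hd => Function.update_of_ne (by rintro rfl; exact lt_irrefl _ hd) _ _
    convert h1.comp ih using 1
    funext y c
    by_cases hc : c = a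
    · subst hc
      have : h c (fun c => if c ∈ s then y c + h c y else y c) = h c y :=
        hind c _ _ fun d hd => by
          have : d ∉ s := fun hds => absurd (hr d hds) (not_le.2 hd)
          simp [this]
      simp [ha, this]
    · simp [hc]

end Shear

section Triangular

variable {p : ℕ}

lemma triMat_apply_of_le (x : TriCoords p) {i j : Fin p} (h : j ≤ i) :
    triMat x i j = x ⟨(i, j), h⟩ := by
  simp [triMat, h]

lemma memTplus_triMat_iff {x : TriCoords p} : memTplus (triMat x) ↔ x ∈ triPos p := by
  constructor
  · intro h i
    simpa [triMat] using h.2 i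
  · intro h
    refine ⟨fun i j hij => by simp [triMat, hij], fun i => ?_⟩
    simpa [triMat] using h i

lemma triMat_coords {A : Matrix (Fin p) (Fin p) ℝ} (hA : ∀ i j : Fin p, i < j → A i j = 0) :
    triMat (fun q : LowIdx p => A q.1.1 q.1.2) = A := by
  ext i j
  by_cases h : j ≤ i
  · simp [triMat, h]
  · simp [triMat, h, hA i j (not_le.1 h)]

lemma memTplus.isLowerTriangular {A : Matrix (Fin p) (Fin p) ℝ} (hA : memTplus A) :
    A.IsLowerTriangular := fun _ _ h => hA.1 _ _ h

lemma memTplus.det_eq {A : Matrix (Fin p) (Fin p) ℝ} (hA : memTplus A) :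
    A.det = ∏ i, A i i := det_of_isLowerTriangular _ hA.isLowerTriangular

lemma memTplus.det_pos {A : Matrix (Fin p) (Fin p) ℝ} (hA : memTplus A) : 0 < A.det := by
  rw [hA.det_eq]
  exact Finset.prod_pos fun i _ => hA.2 i

lemma mul_diag_of_lower {A B : Matrix (Fin p) (Fin p) ℝ}
    (hA : ∀ i j : Fin p, i < j → A i j = 0) (hB : ∀ i j : Fin p, i < j → B i j = 0)
    (i : Fin p) : (A * B) i i = A i i * B i i := by
  rw [Matrix.mul_apply]
  refine Finset.sum_eq_single i (fun k _ hk => ?_) (by simp)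
  rcases lt_or_gt_of_ne hk with h | h
  · rw [hB k i h, mul_zero]
  · rw [hA i k h, zero_mul]

lemma mul_lower {A B : Matrix (Fin p) (Fin p) ℝ}
    (hA : ∀ i j : Fin p, i < j → A i j = 0) (hB : ∀ i j : Fin p, i < j → B i j = 0)
    (i j : Fin p) (hij : i < j) : (A * B) i j = 0 := by
  rw [Matrix.mul_apply]
  refine Finset.sum_eq_zero fun k _ => ?_
  rcases lt_or_ge i k with h | h
  · rw [hA i k h, zero_mul]
  · rw [hB k j (h.trans_lt hij), mul_zero]

lemma memTplus.mul {A B : Matrix (Fin p) (Fin p) ℝ} (hA : memTplus A) (hB : memTplus B) :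
    memTplus (A * B) := by
  refine ⟨mul_lower hA.1 hB.1, fun i => ?_⟩
  rw [mul_diag_of_lower hA.1 hB.1]
  exact mul_pos (hA.2 i) (hB.2 i)

lemma memTplus.isUnit_det {A : Matrix (Fin p) (Fin p) ℝ} (hA : memTplus A) :
    IsUnit A.det := hA.det_pos.ne'.isUnit

lemma memTplus.inv {A : Matrix (Fin p) (Fin p) ℝ} (hA : memTplus A) : memTplus A⁻¹ := by
  have : Invertible A := A.invertibleOfIsUnitDet hA.isUnit_det
  have hl : ∀ i j : Fin p, i < j → A⁻¹ i j = 0 := fun i j hij =>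
    blockTriangular_inv_of_blockTriangular hA.isLowerTriangular hij
  refine ⟨hl, fun i => ?_⟩
  have h := mul_diag_of_lower hA.1 hl i
  rw [A.mul_nonsing_inv hA.isUnit_det, Matrix.one_apply_eq] at h
  exact pos_of_mul_pos_right (h ▸ one_pos) (hA.2 i).le

lemma memTplus.inv_diag {A : Matrix (Fin p) (Fin p) ℝ} (hA : memTplus A) (i : Fin p) :
    A⁻¹ i i = (A i i)⁻¹ := by
  have h := mul_diag_of_lower hA.1 hA.inv.1 i
  rw [A.mul_nonsing_inv hA.isUnit_det, Matrix.one_apply_eq] at h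
  exact eq_inv_of_mul_eq_one_right h.symm

end Triangular

section LeftInvariance

variable {p : ℕ}

/-- Left multiplication by `A`, read off on the lower triangular coordinates. -/
noncomputable def mulLeftCoords (A : Matrix (Fin p) (Fin p) ℝ) :
    TriCoords p →ₗ[ℝ] TriCoords p where
  toFun x q := (A * triMat x) q.1.1 q.1.2
  map_add' x y := by
    funext q
    simp only [Matrix.mul_apply, Pi.add_apply, ← Finset.sum_add_distrib, ← mul_add]
    refine Finset.sum_congr rfl fun k _ => ?_
    by_cases h : q.1.2 ≤ k <;> simp [triMat, h]
  map_smul' c x := by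
    funext q
    simp only [Matrix.mul_apply, Pi.smul_apply, smul_eq_mul, Finset.mul_sum, RingHom.id_apply]
    refine Finset.sum_congr rfl fun k _ => ?_
    by_cases h : q.1.2 ≤ k
    · simp [triMat, h]
      ring
    · simp [triMat, h]

lemma mulLeftCoords_apply (A : Matrix (Fin p) (Fin p) ℝ) (x : TriCoords p) (q : LowIdx p) :
    mulLeftCoords A x q = (A * triMat x) q.1.1 q.1.2 := rfl

lemma triMat_lower (x : TriCoords p) (i j : Fin p) (h : i < j) : triMat x i j = 0 := by
  simp [triMat, h]

lemma triMat_mulLeftCoords {A : Matrix (Fin p) (Fin p) ℝ}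
    (hA : ∀ i j : Fin p, i < j → A i j = 0) (x : TriCoords p) :
    triMat (mulLeftCoords A x) = A * triMat x :=
  triMat_coords (mul_lower hA (triMat_lower x))

lemma toMatrix'_mulLeftCoords (A : Matrix (Fin p) (Fin p) ℝ) (c d : LowIdx p) :
    LinearMap.toMatrix' (mulLeftCoords A) c d =
      if c.1.2 = d.1.2 then A c.1.1 d.1.1 else 0 := by
  rw [LinearMap.toMatrix'_apply, mulLeftCoords_apply, Matrix.mul_apply]
  obtain ⟨⟨i, j⟩, hij⟩ := c
  obtain ⟨⟨k, l⟩, hkl⟩ := d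
  simp only at hij hkl ⊢
  rw [Finset.sum_eq_single k]
  · by_cases h : j = l
    · subst h
      simp [triMat, show j ≤ k from hkl]
    · by_cases h' : j ≤ k <;> simp [triMat, h, h', Pi.single_apply]
  · intro m _ hm
    by_cases h' : j ≤ m <;> simp [triMat, h', Pi.single_apply, hm]
  · simp

lemma card_lowIdx_row (k : Fin p) :
    Fintype.card {c : LowIdx p // OrderDual.toDual c.1.1 = OrderDual.toDual k} =
      (k : ℕ) + 1 := by
  rw [← Fin.card_Iic k, ← Fintype.card_coe]
  refine Fintype.card_congr
    { toFun := fun c => ⟨c.1.1.2, ?_⟩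
      invFun := fun j => ⟨⟨(k, j.1), Finset.mem_Iic.1 j.2⟩, rfl⟩
      left_inv := ?_
      right_inv := fun j => rfl }
  · have h1 := c.1.2
    have h2 : c.1.1.1 = k := c.2
    rw [h2] at h1
    exact Finset.mem_Iic.2 h1
  · rintro ⟨⟨⟨i, j⟩, hij⟩, hc⟩
    have : i = k := hc
    subst this
    rfl

lemma det_mulLeftCoords {A : Matrix (Fin p) (Fin p) ℝ}
    (hA : ∀ i j : Fin p, i < j → A i j = 0) :
    LinearMap.det (mulLeftCoords A) = ∏ i : Fin p, A i i ^ ((i : ℕ) + 1) := by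
  rw [← LinearMap.det_toMatrix']
  have hb : (LinearMap.toMatrix' (mulLeftCoords A)).BlockTriangular
      (fun c : LowIdx p => OrderDual.toDual c.1.1) := by
    intro c d h
    rw [toMatrix'_mulLeftCoords, hA _ _ (OrderDual.toDual_lt_toDual.1 h), ite_self]
  rw [hb.det_fintype]
  refine Fintype.prod_equiv OrderDual.ofDual _ _ fun k => ?_
  induction k using OrderDual.rec with | toDual k => ?_
  have : (LinearMap.toMatrix' (mulLeftCoords A)).toSquareBlock
      (fun c : LowIdx p => OrderDual.toDual c.1.1) (OrderDual.toDual k) =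
      Matrix.diagonal fun _ => A k k := by
    ext c d
    rw [Matrix.toSquareBlock_def, Matrix.of_apply, toMatrix'_mulLeftCoords, Matrix.diagonal_apply]
    obtain ⟨⟨⟨i, j⟩, hij⟩, hc⟩ := c
    obtain ⟨⟨⟨i', j'⟩, hij'⟩, hd⟩ := d
    have h1 : i = k := hc
    have h2 : i' = k := hd
    subst h1 h2
    simp
  rw [this, Matrix.det_diagonal, Finset.prod_const, Finset.card_univ, card_lowIdx_row]
  rfl

lemma measurableSet_triPos : MeasurableSet (triPos p) := by
  have : triPos p = ⋂ i : Fin p, {x | 0 < x ⟨(i, i), le_rfl⟩} := by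
    ext x; simp [triPos]
  rw [this]
  exact MeasurableSet.iInter fun i => measurableSet_lt measurable_const (measurable_pi_apply _)

lemma image_mulLeftCoords {A : Matrix (Fin p) (Fin p) ℝ} (hA : memTplus A) :
    mulLeftCoords A '' triPos p = triPos p := by
  ext x
  constructor
  · rintro ⟨y, hy, rfl⟩
    rw [← memTplus_triMat_iff, triMat_mulLeftCoords hA.1]
    exact hA.mul (memTplus_triMat_iff.2 hy)
  · intro hx
    refine ⟨mulLeftCoords A⁻¹ x, ?_, ?_⟩
    · rw [← memTplus_triMat_iff, triMat_mulLeftCoords hA.inv.1]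
      exact hA.inv.mul (memTplus_triMat_iff.2 hx)
    · funext q
      rw [mulLeftCoords_apply, triMat_mulLeftCoords hA.inv.1, ← mul_assoc,
        A.mul_nonsing_inv hA.isUnit_det, one_mul, triMat_apply_of_le]

lemma injective_mulLeftCoords {A : Matrix (Fin p) (Fin p) ℝ} (hA : memTplus A) :
    Function.Injective (mulLeftCoords A) := by
  refine Function.LeftInverse.injective (g := mulLeftCoords A⁻¹) fun x => ?_
  funext q
  rw [mulLeftCoords_apply, triMat_mulLeftCoords hA.1, ← mul_assoc,
    A.nonsing_inv_mul hA.isUnit_det, one_mul, triMat_apply_of_le]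

lemma det_mul_gammaDensR {A : Matrix (Fin p) (Fin p) ℝ} (hA : memTplus A) (x : TriCoords p) :
    |LinearMap.det (mulLeftCoords A)| * gammaDensR (mulLeftCoords A x) = gammaDensR x := by
  rw [det_mulLeftCoords hA.1, abs_of_nonneg
    (Finset.prod_nonneg fun i _ => pow_nonneg (hA.2 i).le _), gammaDensR, gammaDensR,
    ← Finset.prod_mul_distrib]
  refine Finset.prod_congr rfl fun i _ => ?_
  rw [mulLeftCoords_apply, mul_diag_of_lower hA.1 (triMat_lower x), mul_zpow,
    triMat_apply_of_le x le_rfl, ← mul_assoc, ← zpow_natCast, ← zpow_add₀ (hA.2 i).ne']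
  simp

/-- The measure `γ` is invariant under left multiplication. -/
lemma lintegral_mul_left {A : Matrix (Fin p) (Fin p) ℝ} (hA : memTplus A)
    (F : Matrix (Fin p) (Fin p) ℝ → ℝ) :
    ∫⁻ x in triPos p, ENNReal.ofReal (F (A * triMat x) * gammaDensR x) =
      ∫⁻ x in triPos p, ENNReal.ofReal (F (triMat x) * gammaDensR x) := by
  conv_rhs => rw [← image_mulLeftCoords hA]
  rw [lintegral_image_eq_lintegral_abs_det_fderiv_mul volume measurableSet_triPos
    (f := mulLeftCoords A) (f' := fun _ => (mulLeftCoords A).toContinuousLinearMap)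
    (fun x _ => (mulLeftCoords A).toContinuousLinearMap.hasFDerivWithinAt)
    (injective_mulLeftCoords hA).injOn]
  refine lintegral_congr fun x => ?_
  rw [← ENNReal.ofReal_mul (abs_nonneg _), triMat_mulLeftCoords hA.1,
    ← det_mul_gammaDensR hA x]
  congr 1
  change _ = |LinearMap.det (mulLeftCoords A)| * _
  ring

lemma wishartDens_eq (n : ℕ) (A T : Matrix (Fin p) (Fin p) ℝ) :
    wishartDens p n A T = wishartDens p n 1 (A * T) := by
  simp [wishartDens]

/-- The risk at `A⁻¹`, transported to the identity. -/
lemma risk_inv (n : ℕ) {A : Matrix (Fin p) (Fin p) ℝ} (hA : memTplus A)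
    (δ : Matrix (Fin p) (Fin p) ℝ → Matrix (Fin p) (Fin p) ℝ) :
    ∫⁻ x in triPos p, ENNReal.ofReal (steinLoss p (A⁻¹ * δ (triMat x) * (A⁻¹)ᵀ) *
        (wishartDens p n A⁻¹ (triMat x) * gammaDensR x)) =
      ∫⁻ x in triPos p, ENNReal.ofReal (steinLoss p (A⁻¹ * δ (A * triMat x) * (A⁻¹)ᵀ) *
        (wishartDens p n 1 (triMat x) * gammaDensR x)) := by
  have h := lintegral_mul_left hA (fun T => steinLoss p (A⁻¹ * δ T * (A⁻¹)ᵀ) *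
    wishartDens p n A⁻¹ T)
  simp only [mul_assoc (steinLoss _ _)] at h
  rw [← h]
  refine lintegral_congr fun x => ?_
  rw [wishartDens_eq n A⁻¹ (A * _), ← mul_assoc A⁻¹ A, A.nonsing_inv_mul hA.isUnit_det, one_mul]

lemma jamesStein_mul (n : ℕ) (A T : Matrix (Fin p) (Fin p) ℝ) :
    jamesStein p n (A * T) = A * jamesStein p n T * Aᵀ := by
  simp only [jamesStein, Matrix.transpose_mul, mul_assoc]

lemma risk_jamesStein (n : ℕ) {Θ : Matrix (Fin p) (Fin p) ℝ} (hΘ : memTplus Θ) :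
    ∫⁻ x in triPos p, ENNReal.ofReal (steinLoss p (Θ * jamesStein p n (triMat x) * Θᵀ) *
        (wishartDens p n Θ (triMat x) * gammaDensR x)) =
      ∫⁻ x in triPos p, ENNReal.ofReal (steinLoss p (jamesStein p n (triMat x)) *
        (wishartDens p n 1 (triMat x) * gammaDensR x)) := by
  have h := lintegral_mul_left hΘ (fun T => steinLoss p (jamesStein p n T) * wishartDens p n 1 T)
  simp only [mul_assoc (steinLoss _ _)] at h
  rw [← h]
  refine lintegral_congr fun x => ?_
  rw [wishartDens_eq, jamesStein_mul]

end LeftInvariance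

section RightTranslation

variable {p : ℕ}

/-- The lower triangular matrix `u * diag (exp a)`, where the coordinates `y` hold the
logarithms `a` on the diagonal and the entries of the unipotent factor `u` below it. -/
noncomputable def expMat (y : TriCoords p) : Matrix (Fin p) (Fin p) ℝ :=
  triMat fun q => (if q.1.1 = q.1.2 then 1 else y q) * Real.exp (y ⟨(q.1.2, q.1.2), le_rfl⟩)

/-- The inverse of `expMat`. -/
noncomputable def logCoords (A : Matrix (Fin p) (Fin p) ℝ) : TriCoords p := fun q =>
  if q.1.1 = q.1.2 then Real.log (A q.1.1 q.1.1) else A q.1.1 q.1.2 / A q.1.2 q.1.2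

lemma expMat_diag (y : TriCoords p) (i : Fin p) :
    expMat y i i = Real.exp (y ⟨(i, i), le_rfl⟩) := by
  simp [expMat, triMat]

lemma expMat_of_lt (y : TriCoords p) {i j : Fin p} (h : j < i) :
    expMat y i j = y ⟨(i, j), h.le⟩ * Real.exp (y ⟨(j, j), le_rfl⟩) := by
  simp [expMat, triMat, h.le, h.ne']

lemma expMat_lower (y : TriCoords p) (i j : Fin p) (h : i < j) : expMat y i j = 0 :=
  triMat_lower _ i j h

lemma memTplus_expMat (y : TriCoords p) : memTplus (expMat y) :=
  ⟨expMat_lower y, fun i => by rw [expMat_diag]; exact Real.exp_pos _⟩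

lemma expMat_logCoords {A : Matrix (Fin p) (Fin p) ℝ} (hA : memTplus A) :
    expMat (logCoords A) = A := by
  ext i j
  rcases lt_trichotomy i j with h | rfl | h
  · rw [expMat_lower _ _ _ h, hA.1 _ _ h]
  · rw [expMat_diag]
    simp [logCoords, Real.exp_log (hA.2 i)]
  · rw [expMat_of_lt _ h]
    simp [logCoords, Real.exp_log (hA.2 j), h.ne', (hA.2 j).ne']

lemma logCoords_expMat (y : TriCoords p) : logCoords (expMat y) = y := by
  funext ⟨⟨i, j⟩, hij⟩
  rcases eq_or_lt_of_le hij with h | h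
  · simp only at h
    subst h
    simp [logCoords, expMat_diag]
  · simp only at h
    simp [logCoords, expMat_diag, expMat_of_lt _ h, h.ne']

lemma logCoords_expMat_mul_diag (y : TriCoords p) {W : Matrix (Fin p) (Fin p) ℝ}
    (hW : memTplus W) (i : Fin p) :
    logCoords (expMat y * W) ⟨(i, i), le_rfl⟩ =
      y ⟨(i, i), le_rfl⟩ + Real.log (W i i) := by
  simp only [logCoords, if_true]
  rw [mul_diag_of_lower (expMat_lower y) hW.1, expMat_diag,
    Real.log_mul (Real.exp_pos _).ne' (hW.2 i).ne', Real.log_exp]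

lemma logCoords_expMat_mul_of_lt (y : TriCoords p) {W : Matrix (Fin p) (Fin p) ℝ}
    (hW : memTplus W) {i j : Fin p} (h : j < i) :
    logCoords (expMat y * W) ⟨(i, j), h.le⟩ = y ⟨(i, j), h.le⟩ +
      ∑ k ∈ Finset.Ioc j i,
        expMat y i k * Real.exp (-y ⟨(j, j), le_rfl⟩) * (W k j / W j j) := by
  simp only [logCoords, h.ne', if_false]
  have hsum : (expMat y * W) i j = expMat y i j * W j j +
      ∑ k ∈ Finset.Ioc j i, expMat y i k * W k j := by
    have hj : j ∉ Finset.Ioc j i := by simp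
    rw [← Finset.sum_insert (f := fun k => expMat y i k * W k j) hj, Finset.Ioc_insert_left h.le,
      Matrix.mul_apply]
    refine (Finset.sum_subset (Finset.subset_univ _) fun k _ hk => ?_).symm
    rcases lt_or_ge i k with h1 | h1
    · rw [expMat_lower y i k h1, zero_mul]
    · have : k < j := by
        by_contra h2
        exact hk (Finset.mem_Icc.2 ⟨not_lt.1 h2, h1⟩)
      rw [hW.1 k j this, mul_zero]
  have he := Real.exp_pos (y ⟨(j, j), le_rfl⟩)
  rw [hsum, mul_diag_of_lower (expMat_lower y) hW.1, expMat_diag, expMat_of_lt y h, add_div,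
    Finset.sum_div]
  congr 1
  · field_simp [he.ne', (hW.2 j).ne']
  · refine Finset.sum_congr rfl fun k _ => ?_
    rw [Real.exp_neg]
    have := (hW.2 j).ne'
    field_simp

lemma measurable_expMat_apply (i j : Fin p) :
    Measurable fun y : TriCoords p => expMat y i j := by
  rcases lt_trichotomy i j with h | rfl | h
  · simp only [expMat_lower _ _ _ h, measurable_const]
  · simp only [expMat_diag]
    exact Real.measurable_exp.comp (measurable_pi_apply _)
  · simp only [expMat_of_lt _ h]
    exact (measurable_pi_apply _).mul (Real.measurable_exp.comp (measurable_pi_apply _))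

/-- In the coordinates `expMat`, right multiplication preserves Lebesgue measure. -/
lemma measurePreserving_mul_right {W : Matrix (Fin p) (Fin p) ℝ} (hW : memTplus W) :
    MeasurePreserving (fun y : TriCoords p => logCoords (expMat y * W)) := by
  convert measurePreserving_add_of_rank (ι := LowIdx p)
    (fun q => (q.1.1 : ℕ) - (q.1.2 : ℕ))
    (fun q y => if q.1.1 = q.1.2 then Real.log (W q.1.1 q.1.1) else
      ∑ k ∈ Finset.Ioc q.1.2 q.1.1, expMat y q.1.1 k *
        Real.exp (-y ⟨(q.1.2, q.1.2), le_rfl⟩) * (W k q.1.2 / W q.1.2 q.1.2)) ?_ ?_ using 1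
  · funext y ⟨⟨i, j⟩, hij⟩
    rcases eq_or_lt_of_le hij with h | h
    · simp only at h
      subst h
      simpa using logCoords_expMat_mul_diag y hW j
    · simp only at h
      simpa [h.ne'] using logCoords_expMat_mul_of_lt y hW h
  · intro q
    by_cases h : q.1.1 = q.1.2
    · simp only [h, if_true, measurable_const]
    · simp only [h, if_false]
      refine Finset.measurable_fun_sum _ fun k _ => ?_
      exact ((measurable_expMat_apply _ _).mul
        (Real.measurable_exp.comp (measurable_pi_apply _).neg)).mul_const _
  · rintro ⟨⟨i, j⟩, hij⟩ y y' hyy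
    by_cases h : i = j
    · simp [h]
    · have hlt : j < i := lt_of_le_of_ne hij (Ne.symm h)
      have hd : ∀ k : Fin p, y ⟨(k, k), le_rfl⟩ = y' ⟨(k, k), le_rfl⟩ := fun k =>
        hyy _ (by simpa using hlt)
      simp only [h, if_false]
      refine Finset.sum_congr rfl fun k hk => ?_
      rw [Finset.mem_Ioc] at hk
      have : expMat y i k = expMat y' i k := by
        rcases eq_or_lt_of_le hk.2 with rfl | h2
        · rw [expMat_diag, expMat_diag, hd]
        · rw [expMat_of_lt _ h2, expMat_of_lt _ h2, hd, hyy]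
          have h3 : (j : ℕ) < k := hk.1
          have h4 : (k : ℕ) < i := h2
          simp only
          omega
      rw [this, hd]

/-- Boxes that are almost invariant under right multiplication by a bounded set. -/
lemma exists_almost_invariant_box (p : ℕ) {b θ : ℝ} (hb : 1 ≤ b) (h0 : 0 < θ) (h1 : θ < 1) :
    ∃ r : LowIdx p → ℝ, (∀ q, 0 < r q) ∧
      ∀ V : Matrix (Fin p) (Fin p) ℝ, memTplus V → (∀ i j, |V i j| ≤ b) →
        (∀ i, b⁻¹ ≤ V i i) → ∀ z : TriCoords p, (∀ q, |z q| ≤ θ * r q) →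
          ∀ q, |logCoords (expMat z * V) q| ≤ r q := by
  have hθ : 0 < 1 - θ := by linarith
  have hb0 : 0 < b := by linarith
  obtain ⟨s, hs0, hs⟩ : ∃ s : ℝ, 0 < s ∧ Real.log b ≤ (1 - θ) * s := by
    refine ⟨(Real.log b + 1) / (1 - θ), div_pos ?_ hθ, ?_⟩
    · linarith [Real.log_nonneg hb]
    · rw [mul_div_cancel₀ _ hθ.ne']; linarith
  set E : ℝ := Real.exp s * Real.exp s * (b * b) with hE
  have hE0 : 0 < E := by positivity
  obtain ⟨R, hR1, hR⟩ : ∃ R : ℝ, 1 ≤ R ∧ p * E ≤ (1 - θ) * R := by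
    refine ⟨max 1 (p * E / (1 - θ)), le_max_left _ _, ?_⟩
    calc (p : ℝ) * E = (1 - θ) * (p * E / (1 - θ)) := by field_simp
      _ ≤ _ := mul_le_mul_of_nonneg_left (le_max_right _ _) hθ.le
  have hR0 : 0 < R := by linarith
  refine ⟨fun q => if q.1.1 = q.1.2 then s else R ^ ((q.1.1 : ℕ) - (q.1.2 : ℕ)),
    fun q => by dsimp only; split_ifs <;> positivity, ?_⟩
  intro V hV hVb hVd z hz ⟨⟨i, j⟩, hij⟩
  have hzd : ∀ k : Fin p, |z ⟨(k, k), le_rfl⟩| ≤ s := fun k => by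
    have := hz ⟨(k, k), le_rfl⟩
    simp only [if_true] at this
    nlinarith
  rcases eq_or_lt_of_le hij with h | h
  · simp only at h
    subst h
    rw [logCoords_expMat_mul_diag z hV]
    have hz' := hz ⟨(j, j), le_rfl⟩
    simp only [if_true] at hz' ⊢
    have hlog : |Real.log (V j j)| ≤ Real.log b := by
      rw [abs_le]
      constructor
      · rw [← Real.log_inv]
        exact Real.log_le_log (by positivity) (hVd j)
      · exact Real.log_le_log (hV.2 j) ((le_abs_self _).trans (hVb j j))
    calc _ ≤ _ := abs_add_le _ _
      _ ≤ θ * s + (1 - θ) * s := add_le_add hz' (hlog.trans hs)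
      _ = s := by ring
  · simp only at h
    have hji : (j : ℕ) < i := h
    rw [logCoords_expMat_mul_of_lt z hV h]
    have hz' := hz ⟨(i, j), hij⟩
    simp only [h.ne', if_false] at hz' ⊢
    set m := (i : ℕ) - (j : ℕ) with hm
    have hm1 : 1 ≤ m := by omega
    have hterm : ∀ k ∈ Finset.Ioc j i,
        |expMat z i k * Real.exp (-z ⟨(j, j), le_rfl⟩) * (V k j / V j j)| ≤ R ^ (m - 1) * E := by
      intro k hk
      rw [Finset.mem_Ioc] at hk
      have hjk : (j : ℕ) < k := hk.1
      have hki : (k : ℕ) ≤ i := hk.2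
      have hexp : ∀ k : Fin p, Real.exp (z ⟨(k, k), le_rfl⟩) ≤ Real.exp s := fun k =>
        Real.exp_le_exp.2 ((le_abs_self _).trans (hzd k))
      have e1 : |expMat z i k| ≤ R ^ (m - 1) * Real.exp s := by
        rcases eq_or_lt_of_le hk.2 with rfl | h2
        · rw [expMat_diag, abs_of_pos (Real.exp_pos _)]
          calc _ ≤ 1 * Real.exp s := by rw [one_mul]; exact hexp _
            _ ≤ _ := mul_le_mul_of_nonneg_right (one_le_pow₀ hR1) (Real.exp_pos _).le
        · rw [expMat_of_lt _ h2, abs_mul, abs_of_pos (Real.exp_pos _)]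
          refine mul_le_mul ?_ (hexp _) (Real.exp_pos _).le (by positivity)
          have := hz ⟨(i, k), hk.2⟩
          simp only [h2.ne', if_false] at this
          calc _ ≤ _ := this
            _ ≤ 1 * R ^ ((i : ℕ) - k) := mul_le_mul_of_nonneg_right h1.le (by positivity)
            _ = R ^ ((i : ℕ) - k) := one_mul _
            _ ≤ R ^ (m - 1) := pow_le_pow_right₀ hR1 (by omega)
      have e2 : |Real.exp (-z ⟨(j, j), le_rfl⟩)| ≤ Real.exp s := by
        rw [abs_of_pos (Real.exp_pos _)]
        exact Real.exp_le_exp.2 ((neg_le_abs _).trans (hzd j))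
      have e3 : |V k j / V j j| ≤ b * b := by
        rw [abs_div, abs_of_pos (hV.2 j), div_eq_mul_inv]
        refine mul_le_mul (hVb k j) ?_ (inv_nonneg.2 (hV.2 j).le) hb0.le
        exact inv_le_of_inv_le₀ hb0 (hVd j)
      rw [abs_mul, abs_mul, hE]
      calc _ ≤ R ^ (m - 1) * Real.exp s * Real.exp s * (b * b) :=
            mul_le_mul (mul_le_mul e1 e2 (abs_nonneg _) (by positivity)) e3 (abs_nonneg _)
              (by positivity)
        _ = _ := by ring
    have hcard : ((Finset.Ioc j i).card : ℝ) ≤ p := by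
      exact_mod_cast (Finset.card_le_univ _).trans_eq (Fintype.card_fin p)
    have hsum : |∑ k ∈ Finset.Ioc j i,
        expMat z i k * Real.exp (-z ⟨(j, j), le_rfl⟩) * (V k j / V j j)| ≤ (1 - θ) * R ^ m := by
      calc _ ≤ _ := Finset.abs_sum_le_sum_abs _ _
        _ ≤ (Finset.Ioc j i).card • (R ^ (m - 1) * E) := Finset.sum_le_card_nsmul _ _ _ hterm
        _ = (Finset.Ioc j i).card * (R ^ (m - 1) * E) := nsmul_eq_mul _ _
        _ ≤ p * (R ^ (m - 1) * E) := mul_le_mul_of_nonneg_right hcard (by positivity)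
        _ = p * E * R ^ (m - 1) := by ring
        _ ≤ (1 - θ) * R * R ^ (m - 1) := mul_le_mul_of_nonneg_right hR (by positivity)
        _ = (1 - θ) * R ^ m := by
          rw [mul_assoc, ← pow_succ', Nat.sub_add_cancel hm1]
    calc _ ≤ _ := abs_add_le _ _
      _ ≤ θ * R ^ m + (1 - θ) * R ^ m := add_le_add hz' hsum
      _ = R ^ m := by ring

/-- Averaging over a box in the coordinates `expMat` dominates, after a bounded right
translation, averaging over a slightly smaller box. -/
lemma lintegral_box_le {θ : ℝ} {r : LowIdx p → ℝ} {W : Matrix (Fin p) (Fin p) ℝ}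
    (hW : memTplus W)
    (hr : ∀ z : TriCoords p, (∀ q, |z q| ≤ θ * r q) →
      ∀ q, |logCoords (expMat z * W⁻¹) q| ≤ r q)
    {H : Matrix (Fin p) (Fin p) ℝ → ℝ≥0∞} (hH : Measurable fun y : TriCoords p => H (expMat y)) :
    ∫⁻ y in {y : TriCoords p | ∀ q, |y q| ≤ θ * r q}, H (expMat y) ≤
      ∫⁻ y in {y : TriCoords p | ∀ q, |y q| ≤ r q}, H (expMat y * W) := by
  have hmeas : MeasurableSet {y : TriCoords p | ∀ q, |y q| ≤ θ * r q} := by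
    rw [Set.ofPred_forall]
    exact MeasurableSet.iInter fun q =>
      measurableSet_le (measurable_pi_apply q).abs measurable_const
  have hmp := measurePreserving_mul_right hW
  rw [← hmp.setLIntegral_comp_preimage hmeas hH]
  have hmul : ∀ y, expMat (logCoords (expMat y * W)) = expMat y * W := fun y =>
    expMat_logCoords ((memTplus_expMat y).mul hW)
  simp only [hmul]
  refine lintegral_mono_set fun y hy => ?_
  have := hr _ hy
  rwa [hmul, mul_assoc, W.mul_nonsing_inv hW.isUnit_det, mul_one, logCoords_expMat] at this

end RightTranslation

section GaussianMoments

lemma integrable_pow_mul_gaussian (m : ℕ) :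
    Integrable fun t : ℝ => t ^ m * Real.exp (-(1 / 2) * t ^ 2) := by
  have := integrable_rpow_mul_exp_neg_mul_sq (b := 1 / 2) (by norm_num) (s := m)
    (by have : (0 : ℝ) ≤ m := m.cast_nonneg
        linarith)
  simpa only [Real.rpow_natCast] using this

lemma hasDerivAt_gaussian (t : ℝ) :
    HasDerivAt (fun t : ℝ => Real.exp (-(1 / 2) * t ^ 2))
      (-t * Real.exp (-(1 / 2) * t ^ 2)) t := by
  have h := (((hasDerivAt_pow 2 t).const_mul (-(1 / 2) : ℝ))).exp
  convert h using 1
  simp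
  ring

lemma hasDerivAt_pow_mul_gaussian (m : ℕ) (t : ℝ) :
    HasDerivAt (fun t : ℝ => t ^ (m + 1) * Real.exp (-(1 / 2) * t ^ 2))
      ((m + 1) * (t ^ m * Real.exp (-(1 / 2) * t ^ 2)) -
        t ^ (m + 2) * Real.exp (-(1 / 2) * t ^ 2)) t := by
  refine ((hasDerivAt_pow (m + 1) t).mul (hasDerivAt_gaussian t)).congr_deriv ?_
  rw [Nat.add_sub_cancel]
  push_cast
  ring

lemma integral_pow_mul_gaussian_Ioi (m : ℕ) :
    ∫ t in Set.Ioi (0 : ℝ), t ^ (m + 2) * Real.exp (-(1 / 2) * t ^ 2) =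
      (m + 1) * ∫ t in Set.Ioi (0 : ℝ), t ^ m * Real.exp (-(1 / 2) * t ^ 2) := by
  have i0 := (integrable_pow_mul_gaussian m).integrableOn (s := Set.Ioi 0)
  have i1 := (integrable_pow_mul_gaussian (m + 1)).integrableOn (s := Set.Ioi 0)
  have i2 := (integrable_pow_mul_gaussian (m + 2)).integrableOn (s := Set.Ioi 0)
  have i' := (i0.const_mul ((m : ℝ) + 1)).sub i2
  have ht := tendsto_zero_of_hasDerivAt_of_integrableOn_Ioi (a := 0)
    (fun t _ => hasDerivAt_pow_mul_gaussian m t) i' i1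
  have h := integral_Ioi_of_hasDerivAt_of_tendsto' (a := 0)
    (fun t _ => hasDerivAt_pow_mul_gaussian m t) i' ht
  rw [integral_sub (i0.const_mul _) i2, integral_const_mul] at h
  simp only [ne_eq, Nat.add_eq_zero_iff, one_ne_zero, and_false, not_false_eq_true, zero_pow,
    zero_mul, sub_zero] at h
  linarith

lemma integral_sq_mul_gaussian :
    ∫ t : ℝ, t ^ 2 * Real.exp (-(1 / 2) * t ^ 2) = ∫ t : ℝ, Real.exp (-(1 / 2) * t ^ 2) := by
  have i0 := integrable_pow_mul_gaussian 0
  have i2 := integrable_pow_mul_gaussian 2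
  have h := integral_eq_zero_of_hasDerivAt_of_integrable (hasDerivAt_pow_mul_gaussian 0)
    ((i0.const_mul _).sub i2) (integrable_pow_mul_gaussian 1)
  rw [integral_sub (i0.const_mul _) i2, integral_const_mul] at h
  simp only [pow_zero, one_mul] at h
  push_cast at h
  linarith

lemma integral_id_mul_gaussian : ∫ t : ℝ, t * Real.exp (-(1 / 2) * t ^ 2) = 0 := by
  have i0 : Integrable fun t : ℝ => Real.exp (-(1 / 2) * t ^ 2) := by
    simpa using integrable_pow_mul_gaussian 0
  have i1 : Integrable fun t : ℝ => -t * Real.exp (-(1 / 2) * t ^ 2) := by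
    simpa using (integrable_pow_mul_gaussian 1).neg
  have h := integral_eq_zero_of_hasDerivAt_of_integrable hasDerivAt_gaussian i1 i0
  simpa [integral_neg] using h

end GaussianMoments

section WishartMeasure

variable {p : ℕ}

/-- The density, up to a constant, of one entry of the Wishart Cholesky factor. -/
noncomputable def entryDens (n : ℕ) (c : LowIdx p) (t : ℝ) : ℝ :=
  if c.1.1 = c.1.2 then
    (Set.Ioi (0 : ℝ)).indicator
      (fun t => t ^ (n - (c.1.1 + 1)) * Real.exp (-(1 / 2) * t ^ 2)) t
  else Real.exp (-(1 / 2) * t ^ 2)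

/-- The normalized second moment of one entry. -/
noncomputable def entryVar (n : ℕ) (c : LowIdx p) : ℝ :=
  if c.1.1 = c.1.2 then (n : ℝ) - c.1.1 else 1

lemma entryDens_nonneg (n : ℕ) (c : LowIdx p) (t : ℝ) : 0 ≤ entryDens n c t := by
  unfold entryDens
  split_ifs
  · exact Set.indicator_nonneg (fun t ht => mul_nonneg (pow_nonneg (le_of_lt ht) _)
      (Real.exp_pos _).le) t
  · exact (Real.exp_pos _).le

lemma measurable_entryDens (n : ℕ) (c : LowIdx p) : Measurable (entryDens n c) := by
  unfold entryDens
  by_cases h : c.1.1 = c.1.2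
  · simp only [h, if_true]
    exact Measurable.indicator (by fun_prop) measurableSet_Ioi
  · simp only [h, if_false]
    fun_prop

lemma pow_mul_entryDens_diag (n k : ℕ) {c : LowIdx p} (h : c.1.1 = c.1.2) :
    (fun t => t ^ k * entryDens n c t) = (Set.Ioi (0 : ℝ)).indicator
      (fun t => t ^ (n - (c.1.1 + 1) + k) * Real.exp (-(1 / 2) * t ^ 2)) := by
  funext t
  by_cases ht : t ∈ Set.Ioi (0 : ℝ)
  · simp only [entryDens, h, if_true, Set.indicator_of_mem ht]
    ring
  · simp only [entryDens, h, if_true, Set.indicator_of_notMem ht, mul_zero]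

lemma integrable_pow_mul_entryDens (n k : ℕ) (c : LowIdx p) :
    Integrable fun t => t ^ k * entryDens n c t := by
  by_cases h : c.1.1 = c.1.2
  · rw [pow_mul_entryDens_diag n k h]
    exact (integrable_pow_mul_gaussian _).indicator measurableSet_Ioi
  · simpa only [entryDens, h, if_false] using integrable_pow_mul_gaussian k

lemma integral_entryDens_pos (n : ℕ) (c : LowIdx p) : 0 < ∫ t, entryDens n c t := by
  have hi : Integrable (entryDens n c) := by simpa using integrable_pow_mul_entryDens n 0 c
  rw [integral_pos_iff_support_of_nonneg (entryDens_nonneg n c) hi]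
  refine lt_of_lt_of_le ?_ (measure_mono (s := Set.Ioo 0 1) fun t ht => ?_)
  · simp
  · rw [Function.mem_support]
    have h0 : (0 : ℝ) < t := ht.1
    unfold entryDens
    split_ifs
    · rw [Set.indicator_of_mem (Set.mem_Ioi.2 h0)]
      positivity
    · positivity

lemma integral_sq_mul_entryDens {n : ℕ} (hn : p ≤ n) (c : LowIdx p) :
    ∫ t, t ^ 2 * entryDens n c t = entryVar n c * ∫ t, entryDens n c t := by
  by_cases h : c.1.1 = c.1.2
  · have h0 := pow_mul_entryDens_diag n 0 h
    simp only [pow_zero, one_mul, add_zero] at h0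
    rw [pow_mul_entryDens_diag n 2 h, h0, integral_indicator measurableSet_Ioi,
      integral_indicator measurableSet_Ioi, integral_pow_mul_gaussian_Ioi]
    have : (c.1.1 : ℕ) + 1 ≤ n := by omega
    simp [entryVar, h] at this ⊢
    rw [Nat.cast_sub this]
    push_cast
    left
    ring
  · simpa only [entryDens, entryVar, h, if_false, one_mul] using integral_sq_mul_gaussian

lemma integral_id_mul_entryDens (n : ℕ) {c : LowIdx p} (h : c.1.1 ≠ c.1.2) :
    ∫ t, t * entryDens n c t = 0 := by
  simpa only [entryDens, h, if_false] using integral_id_mul_gaussian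

/-- The unnormalized joint density of the Wishart Cholesky factor. -/
noncomputable def jointDens (n : ℕ) (x : TriCoords p) : ℝ := ∏ c, entryDens n c (x c)

lemma jointDens_nonneg (n : ℕ) (x : TriCoords p) : 0 ≤ jointDens n x :=
  Finset.prod_nonneg fun _ _ => entryDens_nonneg _ _ _

lemma measurable_jointDens (n : ℕ) : Measurable (jointDens (p := p) n) :=
  Finset.measurable_fun_prod _ fun c _ => (measurable_entryDens n c).comp (measurable_pi_apply c)

lemma prod_lowIdx {M : Type*} [CommMonoid M] (g : Fin p × Fin p → M)
    (hg : ∀ q, ¬ q.2 ≤ q.1 → g q = 1) : ∏ c : LowIdx p, g c.1 = ∏ q, g q := by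
  rw [← Fintype.prod_subtype_mul_prod_subtype (fun q : Fin p × Fin p => q.2 ≤ q.1) g,
    Finset.prod_eq_one (s := Finset.univ (α := {q : Fin p × Fin p // ¬ q.2 ≤ q.1}))
      fun q _ => hg q.1 q.2, mul_one]

lemma sum_lowIdx_sq (x : TriCoords p) :
    ∑ c, x c ^ 2 = (triMat x * (triMat x)ᵀ).trace := by
  have h := prod_lowIdx (M := Multiplicative ℝ)
    (fun q => Multiplicative.ofAdd (triMat x q.1 q.2 ^ 2))
    (fun q hq => by simp [triMat, hq])
  have h' : ∑ c : LowIdx p, triMat x c.1.1 c.1.2 ^ 2 = ∑ q : Fin p × Fin p, triMat x q.1 q.2 ^ 2 :=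
    h
  rw [Fintype.sum_prod_type] at h'
  simp only [Matrix.trace, Matrix.diag_apply, Matrix.mul_apply, Matrix.transpose_apply, ← sq]
  rw [← h']
  exact Finset.sum_congr rfl fun c _ => by rw [triMat_apply_of_le x c.2]

lemma prod_lowIdx_diag (a : Fin p → ℝ) :
    ∏ c : LowIdx p, (if c.1.1 = c.1.2 then a c.1.1 else 1) = ∏ i, a i := by
  rw [prod_lowIdx (fun q : Fin p × Fin p => if q.1 = q.2 then a q.1 else 1), Fintype.prod_prod_type]
  · simp
  · intro q hq
    rw [if_neg]
    intro h
    exact hq h.ge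

lemma wishartDens_mul_gammaDensR {n : ℕ} (hn : p ≤ n) {x : TriCoords p} (hx : x ∈ triPos p) :
    wishartDens p n 1 (triMat x) * gammaDensR x = (wishartC p n)⁻¹ * jointDens n x := by
  have h1 : jointDens n x =
      (∏ i : Fin p, x ⟨(i, i), le_rfl⟩ ^ (n - ((i : ℕ) + 1))) *
        Real.exp (-(1 / 2) * (triMat x * (triMat x)ᵀ).trace) := by
    rw [← sum_lowIdx_sq, Finset.mul_sum, Real.exp_sum,
      ← prod_lowIdx_diag (fun i => x ⟨(i, i), le_rfl⟩ ^ (n - ((i : ℕ) + 1))),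
      ← Finset.prod_mul_distrib]
    refine Finset.prod_congr rfl fun c _ => ?_
    obtain ⟨⟨i, j⟩, hij⟩ := c
    by_cases h : i = j
    · subst h
      have : x ⟨(i, i), hij⟩ ∈ Set.Ioi (0 : ℝ) := hx i
      simp [entryDens, Set.indicator_of_mem this]
    · simp [entryDens, h]
  have h2 : (triMat x).det ^ n * gammaDensR x =
      ∏ i : Fin p, x ⟨(i, i), le_rfl⟩ ^ (n - ((i : ℕ) + 1)) := by
    rw [(memTplus_triMat_iff.2 hx).det_eq, gammaDensR, ← Finset.prod_pow,
      ← Finset.prod_mul_distrib]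
    refine Finset.prod_congr rfl fun i _ => ?_
    rw [triMat_apply_of_le x le_rfl, ← zpow_natCast, ← zpow_natCast, ← zpow_add₀ (hx i).ne',
      Nat.cast_sub (by omega)]
    push_cast
    congr 1
  rw [h1, ← h2, wishartDens, one_mul]
  ring

lemma jointDens_eq_zero (n : ℕ) {x : TriCoords p} (hx : x ∉ triPos p) : jointDens n x = 0 := by
  obtain ⟨i, hi⟩ : ∃ i : Fin p, ¬ 0 < x ⟨(i, i), le_rfl⟩ := by
    simpa only [triPos, Set.mem_ofPred_eq, not_forall] using hx
  refine Finset.prod_eq_zero (Finset.mem_univ ⟨(i, i), le_rfl⟩) ?_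
  have : x ⟨(i, i), le_rfl⟩ ∉ Set.Ioi (0 : ℝ) := hi
  simp [entryDens, Set.indicator_of_notMem this]

/-- The unnormalized distribution of the Wishart Cholesky factor. -/
noncomputable def wishartMeasure (p n : ℕ) : Measure (TriCoords p) :=
  volume.withDensity fun x => ENNReal.ofReal (jointDens n x)

lemma wishartC_pos {n : ℕ} (hn : p ≤ n) : 0 < wishartC p n := by
  have : 0 < ∏ i : Fin p, Real.Gamma (((n : ℝ) - (i : ℕ)) / 2) := by
    refine Finset.prod_pos fun i _ => Real.Gamma_pos_of_pos ?_
    have : ((i : ℕ) : ℝ) < n := by exact_mod_cast i.2.trans_le hn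
    linarith
  have := Real.pi_pos
  unfold wishartC
  positivity

lemma lintegral_wishartDens {n : ℕ} (hn : p ≤ n) (F : TriCoords p → ℝ) :
    ∫⁻ x in triPos p, ENNReal.ofReal (F x * (wishartDens p n 1 (triMat x) * gammaDensR x)) =
      ENNReal.ofReal (wishartC p n)⁻¹ *
        ∫⁻ x, ENNReal.ofReal (F x) ∂(wishartMeasure p n) := by
  have hC := inv_nonneg.2 (wishartC_pos hn).le
  rw [wishartMeasure, lintegral_withDensity_eq_lintegral_mul_non_measurable _
    (measurable_jointDens n).ennreal_ofReal (by simp), ← lintegral_const_mul' _ _ ofReal_ne_top,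
    ← lintegral_indicator measurableSet_triPos]
  refine lintegral_congr fun x => ?_
  by_cases hx : x ∈ triPos p
  · rw [Set.indicator_of_mem hx, wishartDens_mul_gammaDensR hn hx, Pi.mul_apply,
      ← ENNReal.ofReal_mul (jointDens_nonneg n x), ← ENNReal.ofReal_mul hC]
    congr 1
    ring
  · simp [Set.indicator_of_notMem hx, jointDens_eq_zero n hx]

lemma ae_mem_triPos (p n : ℕ) : ∀ᵐ x ∂(wishartMeasure p n), x ∈ triPos p := by
  rw [wishartMeasure, ae_withDensity_iff (measurable_jointDens n).ennreal_ofReal]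
  refine Filter.Eventually.of_forall fun x hx => ?_
  by_contra h
  exact hx (by simp [jointDens_eq_zero n h])

lemma integrable_wishartMeasure_iff (n : ℕ) (F : TriCoords p → ℝ) :
    Integrable F (wishartMeasure p n) ↔ Integrable fun x => F x * jointDens n x := by
  rw [wishartMeasure, integrable_withDensity_iff (measurable_jointDens n).ennreal_ofReal (by simp)]
  simp only [ENNReal.toReal_ofReal (jointDens_nonneg n _)]

lemma integral_wishartMeasure (n : ℕ) (F : TriCoords p → ℝ) :
    ∫ x, F x ∂(wishartMeasure p n) = ∫ x, F x * jointDens n x := by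
  rw [wishartMeasure, integral_withDensity_eq_integral_toReal_smul
    (measurable_jointDens n).ennreal_ofReal (by simp)]
  simp only [ENNReal.toReal_ofReal (jointDens_nonneg n _), smul_eq_mul, mul_comm]

lemma mul_mul_jointDens (n : ℕ) (c d : LowIdx p) (x : TriCoords p) :
    x c * x d * jointDens n x = ∏ e, (fun (e : LowIdx p) (t : ℝ) =>
      t ^ ((if e = c then 1 else 0) + (if e = d then 1 else 0)) * entryDens n e t) e (x e) := by
  simp only [pow_add, Finset.prod_mul_distrib, jointDens, pow_ite, pow_one, pow_zero,
    Finset.prod_ite_eq', Finset.mem_univ, if_true]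

lemma integral_mul_wishartMeasure (n : ℕ) (c d : LowIdx p) :
    ∫ x, x c * x d ∂(wishartMeasure p n) = ∏ e : LowIdx p, ∫ t : ℝ,
      t ^ ((if e = c then 1 else 0) + (if e = d then 1 else 0)) * entryDens n e t := by
  rw [integral_wishartMeasure, ← integral_fintype_prod_volume_eq_prod]
  simp only [mul_mul_jointDens]

lemma integrable_mul_wishartMeasure (n : ℕ) (c d : LowIdx p) :
    Integrable (fun x => x c * x d) (wishartMeasure p n) := by
  rw [integrable_wishartMeasure_iff]
  simp only [mul_mul_jointDens]
  exact Integrable.fintype_prod fun e => integrable_pow_mul_entryDens n _ e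

instance isFiniteMeasure_wishartMeasure (p n : ℕ) : IsFiniteMeasure (wishartMeasure p n) := by
  have h : Integrable (fun _ => (1 : ℝ)) (wishartMeasure p n) := by
    rw [integrable_wishartMeasure_iff]
    simp only [one_mul]
    exact Integrable.fintype_prod fun e => by simpa using integrable_pow_mul_entryDens n 0 e
  exact (integrable_const_iff_isFiniteMeasure one_ne_zero).1 h

lemma wishartMeasure_real_univ (p n : ℕ) :
    (wishartMeasure p n).real Set.univ = ∏ e : LowIdx p, ∫ t, entryDens n e t := by
  have h := integral_wishartMeasure n (fun _ : TriCoords p => (1 : ℝ))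
  simp only [one_mul, integral_const, smul_eq_mul, mul_one] at h
  rw [h, ← integral_fintype_prod_volume_eq_prod]
  rfl

lemma wishartMeasure_real_univ_pos (p n : ℕ) : 0 < (wishartMeasure p n).real Set.univ := by
  rw [wishartMeasure_real_univ]
  exact Finset.prod_pos fun e _ => integral_entryDens_pos n e

lemma integral_mul_of_ne (n : ℕ) {c d : LowIdx p} (hcd : c ≠ d) (hc : c.1.1 ≠ c.1.2) :
    ∫ x, x c * x d ∂(wishartMeasure p n) = 0 := by
  rw [integral_mul_wishartMeasure]
  refine Finset.prod_eq_zero (Finset.mem_univ c) ?_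
  simpa [hcd] using integral_id_mul_entryDens n hc

lemma integral_sq_wishartMeasure {n : ℕ} (hn : p ≤ n) (c : LowIdx p) :
    ∫ x, x c * x c ∂(wishartMeasure p n) =
      entryVar n c * (wishartMeasure p n).real Set.univ := by
  rw [integral_mul_wishartMeasure, wishartMeasure_real_univ,
    ← Finset.mul_prod_erase _ _ (Finset.mem_univ c),
    ← Finset.mul_prod_erase _ _ (Finset.mem_univ c), ← mul_assoc, ← integral_sq_mul_entryDens hn c]
  congr 1
  · simp
  · refine Finset.prod_congr rfl fun e he => ?_
    simp [Finset.ne_of_mem_erase he]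

lemma integrable_triMat_mul (n : ℕ) (i j k : Fin p) :
    Integrable (fun x => triMat x i j * triMat x i k) (wishartMeasure p n) := by
  by_cases hj : j ≤ i
  · by_cases hk : k ≤ i
    · simpa [triMat, hj, hk] using integrable_mul_wishartMeasure n ⟨(i, j), hj⟩ ⟨(i, k), hk⟩
    · simp [triMat, hk]
  · simp [triMat, hj]

lemma integrable_gram (n : ℕ) (j k : Fin p) :
    Integrable (fun x => ((triMat x)ᵀ * triMat x) j k) (wishartMeasure p n) := by
  simp only [Matrix.mul_apply, Matrix.transpose_apply]
  exact integrable_finsetSum _ fun i _ => integrable_triMat_mul n i j k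

lemma integral_gram_of_ne (n : ℕ) {j k : Fin p} (hjk : j ≠ k) :
    ∫ x, ((triMat x)ᵀ * triMat x) j k ∂(wishartMeasure p n) = 0 := by
  wlog h : j < k generalizing j k
  · rw [← this hjk.symm (lt_of_le_of_ne (not_lt.1 h) hjk.symm)]
    refine integral_congr_ae (Filter.Eventually.of_forall fun x => ?_)
    simp only [Matrix.mul_apply, Matrix.transpose_apply, mul_comm]
  simp only [Matrix.mul_apply, Matrix.transpose_apply]
  rw [integral_finsetSum _ fun i _ => integrable_triMat_mul n i j k]
  refine Finset.sum_eq_zero fun i _ => ?_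
  by_cases hk : k ≤ i
  · have hji : j < i := h.trans_le hk
    have := integral_mul_of_ne (p := p) n (c := ⟨(i, j), hji.le⟩) (d := ⟨(i, k), hk⟩)
      (by simpa using hjk) hji.ne'
    simpa [triMat, hji.le, hk] using this
  · simp [triMat, hk]

lemma integral_gram_diag {n : ℕ} (hn : p ≤ n) (j : Fin p) :
    ∫ x, ((triMat x)ᵀ * triMat x) j j ∂(wishartMeasure p n) =
      ((n : ℝ) + p - 2 * (j : ℕ) - 1) * (wishartMeasure p n).real Set.univ := by
  simp only [Matrix.mul_apply, Matrix.transpose_apply]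
  rw [integral_finsetSum _ fun i _ => integrable_triMat_mul n i j j]
  have h : ∀ i : Fin p, ∫ x, triMat x i j * triMat x i j ∂(wishartMeasure p n) =
      ((if i = j then (n : ℝ) - j - 1 else 0) + (if i ∈ Finset.Ici j then 1 else 0)) *
        (wishartMeasure p n).real Set.univ := by
    intro i
    by_cases hij : j ≤ i
    · have h1 := integral_sq_wishartMeasure hn (⟨(i, j), hij⟩ : LowIdx p)
      by_cases h2 : i = j
      · subst h2
        simpa [triMat, entryVar] using h1
      · simpa [triMat, entryVar, hij, h2] using h1
    · have h2 : i ≠ j := fun h => hij h.ge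
      simp [triMat, hij, h2]
  simp only [h]
  rw [← Finset.sum_mul, Finset.sum_add_distrib, Finset.sum_ite_eq', Finset.sum_ite_mem,
    Finset.univ_inter, Finset.sum_const, Fin.card_Ici, if_pos (Finset.mem_univ _), nsmul_eq_mul,
    Nat.cast_sub j.2.le]
  ring

end WishartMeasure

section Measurability

variable {p : ℕ}

instance borelSpace_matrix : BorelSpace (Matrix (Fin p) (Fin p) ℝ) :=
  inferInstanceAs (BorelSpace (Fin p → Fin p → ℝ))

instance secondCountableTopology_matrix :
    SecondCountableTopology (Matrix (Fin p) (Fin p) ℝ) :=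
  inferInstanceAs (SecondCountableTopology (Fin p → Fin p → ℝ))

lemma measurable_matrix_iff {α : Type*} [MeasurableSpace α]
    {f : α → Matrix (Fin p) (Fin p) ℝ} :
    Measurable f ↔ ∀ i j, Measurable fun a => f a i j := by
  have h : Measurable f ↔ @Measurable α (Fin p → Fin p → ℝ) _ _ f := Iff.rfl
  exact h.trans (measurable_pi_iff.trans (forall_congr' fun i => measurable_pi_iff))

lemma measurable_triMat : Measurable (triMat (p := p)) := by
  refine measurable_matrix_iff.2 fun i j => ?_
  by_cases h : j ≤ i
  · simpa only [triMat_apply_of_le _ h] using measurable_pi_apply _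
  · simp only [triMat_lower _ _ _ (not_le.1 h), measurable_const]

lemma measurable_expMat : Measurable (expMat (p := p)) :=
  measurable_matrix_iff.2 measurable_expMat_apply

lemma measurable_matrix_det : Measurable (Matrix.det : Matrix (Fin p) (Fin p) ℝ → ℝ) :=
  (continuous_id.matrix_det).measurable

lemma measurable_matrix_inv :
    Measurable (fun A : Matrix (Fin p) (Fin p) ℝ => A⁻¹) := by
  simp only [Matrix.inv_def, Ring.inverse_eq_inv']
  refine measurable_matrix_iff.2 fun i j => ?_
  simp only [Matrix.smul_apply, smul_eq_mul]
  exact measurable_matrix_det.inv.mul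
    (measurable_matrix_iff.1 (continuous_id.matrix_adjugate).measurable i j)

lemma measurable_matrix_transpose :
    Measurable (fun A : Matrix (Fin p) (Fin p) ℝ => Aᵀ) :=
  (continuous_id.matrix_transpose).measurable

lemma measurable_steinLoss : Measurable (steinLoss p) :=
  ((continuous_id.matrix_trace).measurable.sub
    (Real.measurable_log.comp measurable_matrix_det)).sub_const _

end Measurability

section PosDef

variable {p : ℕ}

lemma mul_sub_mul_log_ge {a m t : ℝ} (ha : 0 < a) (hm : 0 < m) (ht : 0 < t) :
    m - m * Real.log m + m * Real.log a ≤ a * t - m * Real.log t := by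
  have h := Real.log_le_sub_one_of_pos (x := a * t / m) (by positivity)
  rw [Real.log_div (by positivity) hm.ne', Real.log_mul ha.ne' ht.ne'] at h
  have h2 := mul_le_mul_of_nonneg_left h hm.le
  have h3 : m * (a * t / m - 1) = a * t - m := by field_simp
  rw [h3] at h2
  linarith

lemma mul_trace_sub_mul_log_det_ge {X : Matrix (Fin p) (Fin p) ℝ} (hX : X.PosDef)
    {a m : ℝ} (ha : 0 < a) (hm : 0 < m) :
    p * (m - m * Real.log m + m * Real.log a) ≤ a * X.trace - m * Real.log X.det := by
  have h1 : X.trace = ∑ i, hX.1.eigenvalues i := by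
    simpa using hX.1.trace_eq_sum_eigenvalues
  have h2 : X.det = ∏ i, hX.1.eigenvalues i := by
    simpa using hX.1.det_eq_prod_eigenvalues
  rw [h1, h2, Real.log_prod fun i _ => (hX.eigenvalues_pos i).ne', Finset.mul_sum,
    Finset.mul_sum, ← Finset.sum_sub_distrib]
  calc (p : ℝ) * (m - m * Real.log m + m * Real.log a)
      = ∑ _i : Fin p, (m - m * Real.log m + m * Real.log a) := by
        rw [Finset.sum_const, Finset.card_univ, Fintype.card_fin, nsmul_eq_mul]
    _ ≤ _ := Finset.sum_le_sum fun i _ => mul_sub_mul_log_ge ha hm (hX.eigenvalues_pos i)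

lemma steinLoss_nonneg {X : Matrix (Fin p) (Fin p) ℝ} (hX : X.PosDef) : 0 ≤ steinLoss p X := by
  have := mul_trace_sub_mul_log_det_ge hX one_pos one_pos
  simp only [Real.log_one, mul_zero, one_mul, mul_one, sub_zero, add_zero] at this
  unfold steinLoss
  linarith

lemma posDef_conj {X A : Matrix (Fin p) (Fin p) ℝ} (hX : X.PosDef) (hA : IsUnit A.det) :
    (A * X * Aᵀ).PosDef := by
  have h := hX.mul_mul_conjTranspose_same (B := A)
    (Matrix.vecMul_injective_of_isUnit ((Matrix.isUnit_iff_isUnit_det A).2 hA))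
  simpa only [Matrix.conjTranspose_eq_transpose_of_trivial] using h

open scoped MatrixOrder Matrix.Norms.L2Operator in
/-- Submultiplicativity of the trace in the form used for truncation. -/
lemma trace_conj_le {X : Matrix (Fin p) (Fin p) ℝ} (hX : X.PosSemidef)
    (A : Matrix (Fin p) (Fin p) ℝ) :
    (A * X * Aᵀ).trace ≤ X.trace * (Aᵀ * A).trace := by
  obtain ⟨B, rfl⟩ : ∃ B : Matrix (Fin p) (Fin p) ℝ, X = Bᵀ * B := by
    obtain ⟨B, hB⟩ := CStarAlgebra.nonneg_iff_eq_star_mul_self.mp hX.nonneg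
    exact ⟨B, by rw [hB, Matrix.star_eq_conjTranspose,
      Matrix.conjTranspose_eq_transpose_of_trivial]⟩
  have h1 : (A * (Bᵀ * B) * Aᵀ).trace = ∑ i, ∑ j, (∑ k, A i k * B j k) ^ 2 := by
    rw [show A * (Bᵀ * B) * Aᵀ = (A * Bᵀ) * (A * Bᵀ)ᵀ by
      simp only [Matrix.transpose_mul, Matrix.transpose_transpose, Matrix.mul_assoc]]
    simp [Matrix.trace, Matrix.mul_apply, sq, mul_comm]
  have h2 : (Bᵀ * B).trace = ∑ j, ∑ k, B j k ^ 2 := by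
    rw [Matrix.trace_mul_comm]
    simp [Matrix.trace, Matrix.mul_apply, sq]
  have h3 : (Aᵀ * A).trace = ∑ i, ∑ k, A i k ^ 2 := by
    rw [Matrix.trace_mul_comm]
    simp [Matrix.trace, Matrix.mul_apply, sq]
  rw [h1, h2, h3, mul_comm, Finset.sum_mul_sum]
  exact Finset.sum_le_sum fun i _ => Finset.sum_le_sum fun j _ =>
    Finset.sum_mul_sq_le_sq_mul_sq _ _ _

end PosDef

section BayesBound

variable {p : ℕ}

/-- The diagonal of the mean of `TᵀT`. -/
noncomputable def gramMean (p n : ℕ) (i : Fin p) : ℝ := (n : ℝ) + p - 2 * (i : ℕ) - 1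

lemma one_le_gramMean {n : ℕ} (hn : p ≤ n) (i : Fin p) : 1 ≤ gramMean p n i := by
  have h1 : ((i : ℕ) : ℝ) + 1 ≤ p := by exact_mod_cast i.2
  have h2 : (p : ℝ) ≤ n := by exact_mod_cast hn
  unfold gramMean
  linarith

lemma jamesStein_eq (n : ℕ) (T : Matrix (Fin p) (Fin p) ℝ) :
    jamesStein p n T = T * Matrix.diagonal (fun i => (gramMean p n i)⁻¹) * Tᵀ := rfl

lemma posDef_diagonal_gramMean_inv {n : ℕ} (hn : p ≤ n) :
    (Matrix.diagonal fun i => (gramMean p n i)⁻¹).PosDef :=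
  Matrix.PosDef.diagonal fun i => inv_pos.2 (one_pos.trans_le (one_le_gramMean hn i))

lemma trace_conj_eq (X A : Matrix (Fin p) (Fin p) ℝ) :
    (A * X * Aᵀ).trace = ∑ j, ∑ k, X j k * (Aᵀ * A) k j := by
  rw [Matrix.trace_mul_comm, ← Matrix.mul_assoc, Matrix.trace_mul_comm]
  simp [Matrix.trace, Matrix.mul_apply]

lemma integrable_trace_gram (n : ℕ) :
    Integrable (fun x => ((triMat x)ᵀ * triMat x).trace) (wishartMeasure p n) := by
  simp only [Matrix.trace, Matrix.diag_apply]
  exact integrable_finsetSum _ fun i _ => integrable_gram n i i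

lemma integrable_trace_conj (n : ℕ) (X : Matrix (Fin p) (Fin p) ℝ) :
    Integrable (fun x => (triMat x * X * (triMat x)ᵀ).trace) (wishartMeasure p n) := by
  simp only [trace_conj_eq]
  exact integrable_finsetSum _ fun j _ => integrable_finsetSum _ fun k _ =>
    (integrable_gram n k j).const_mul _

lemma integral_trace_conj {n : ℕ} (hn : p ≤ n) (X : Matrix (Fin p) (Fin p) ℝ) :
    ∫ x, (triMat x * X * (triMat x)ᵀ).trace ∂(wishartMeasure p n) =
      (wishartMeasure p n).real Set.univ * ∑ j, gramMean p n j * X j j := by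
  simp only [trace_conj_eq]
  have hi : ∀ j k, Integrable (fun x => X j k * ((triMat x)ᵀ * triMat x) k j)
      (wishartMeasure p n) := fun j k => (integrable_gram n k j).const_mul _
  rw [integral_finsetSum _ fun j _ => integrable_finsetSum _ fun k _ => hi j k, Finset.mul_sum]
  refine Finset.sum_congr rfl fun j _ => ?_
  rw [integral_finsetSum _ fun k _ => hi j k,
    Finset.sum_eq_single j]
  · rw [integral_const_mul, integral_gram_diag hn]
    unfold gramMean
    ring
  · intro k _ hk
    rw [integral_const_mul, integral_gram_of_ne n hk, mul_zero]
  · simp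

lemma steinLoss_conj {X A : Matrix (Fin p) (Fin p) ℝ} (hX : X.PosDef) (hA : memTplus A) :
    steinLoss p (A * X * Aᵀ) =
      (A * X * Aᵀ).trace - Real.log X.det - 2 * Real.log A.det - p := by
  have h1 := hA.det_pos.ne'
  have h2 := hX.det_pos.ne'
  rw [steinLoss, Matrix.det_mul, Matrix.det_mul, Matrix.det_transpose,
    Real.log_mul (mul_ne_zero h1 h2) h1, Real.log_mul h1 h2]
  ring

/-- The loss of Bayes optimality caused by truncation to `s`. -/
noncomputable def truncationError (p n : ℕ) (s : Set (TriCoords p)) : ℝ :=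
  let m := (wishartMeasure p n).real Set.univ
  let c := (wishartMeasure p n).real s
  let e := ∫ x in sᶜ, ((triMat x)ᵀ * triMat x).trace ∂(wishartMeasure p n)
  p * (m - (c - c * Real.log c + c * Real.log (m - e)))

lemma integrable_steinLoss {n : ℕ} {s : Set (TriCoords p)} (hs : MeasurableSet s)
    (hst : s ⊆ triPos p)
    (hlog : IntegrableOn (fun x => Real.log (triMat x).det) s (wishartMeasure p n))
    {X : Matrix (Fin p) (Fin p) ℝ} (hX : X.PosDef) :
    IntegrableOn (fun x => steinLoss p (triMat x * X * (triMat x)ᵀ)) s (wishartMeasure p n) := by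
  have h : IntegrableOn (fun x => (triMat x * X * (triMat x)ᵀ).trace - Real.log X.det -
      2 * Real.log (triMat x).det - p) s (wishartMeasure p n) :=
    (((integrable_trace_conj n X).integrableOn.sub (integrable_const _)).sub
      (hlog.const_mul 2)).sub (integrable_const _)
  refine h.congr_fun (fun x hx => ?_) hs
  rw [steinLoss_conj hX (memTplus_triMat_iff.2 (hst hx))]

lemma setIntegral_steinLoss_ge {n : ℕ} (hn : p ≤ n) {s : Set (TriCoords p)}
    (hs : MeasurableSet s) (hst : s ⊆ triPos p)
    (hlog : IntegrableOn (fun x => Real.log (triMat x).det) s (wishartMeasure p n))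
    (hpos : 0 < (wishartMeasure p n).real s)
    (he : ∫ x in sᶜ, ((triMat x)ᵀ * triMat x).trace ∂(wishartMeasure p n) <
      (wishartMeasure p n).real Set.univ)
    {X : Matrix (Fin p) (Fin p) ℝ} (hX : X.PosDef) :
    ∫ x in s, steinLoss p (jamesStein p n (triMat x)) ∂(wishartMeasure p n) ≤
      ∫ x in s, steinLoss p (triMat x * X * (triMat x)ᵀ) ∂(wishartMeasure p n) +
        truncationError p n s := by
  set ν := wishartMeasure p n with hν
  set D : Matrix (Fin p) (Fin p) ℝ := Matrix.diagonal fun i => (gramMean p n i)⁻¹ with hD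
  have hDp : D.PosDef := posDef_diagonal_gramMean_inv hn
  have hg : ∀ i, 0 < gramMean p n i := fun i => one_pos.trans_le (one_le_gramMean hn i)
  set S : Matrix (Fin p) (Fin p) ℝ := Matrix.diagonal fun i => √(gramMean p n i) with hS
  have hSdet : IsUnit S.det := by
    rw [hS, Matrix.det_diagonal]
    exact (Finset.prod_pos fun i _ => Real.sqrt_pos.2 (hg i)).ne'.isUnit
  have hY := posDef_conj hX hSdet
  set Y := S * X * Sᵀ with hYdef
  have hYtr : Y.trace = ∑ j, gramMean p n j * X j j := by
    simp only [hYdef, hS, Matrix.diagonal_transpose, Matrix.trace, Matrix.diag_apply,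
      Matrix.mul_diagonal, Matrix.diagonal_mul]
    refine Finset.sum_congr rfl fun i _ => ?_
    rw [mul_right_comm, Real.mul_self_sqrt (hg i).le]
  have hYdet : Real.log Y.det = Real.log X.det - Real.log D.det := by
    have h1 : Y.det * D.det = X.det := by
      rw [hYdef, Matrix.det_mul, Matrix.det_mul, Matrix.det_transpose, hS, hD,
        Matrix.det_diagonal, Matrix.det_diagonal]
      have h2 : (∏ i, √(gramMean p n i)) * (∏ i, √(gramMean p n i)) *
          ∏ i, (gramMean p n i)⁻¹ = 1 := by
        rw [← Finset.prod_mul_distrib, ← Finset.prod_mul_distrib]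
        refine Finset.prod_eq_one fun i _ => ?_
        rw [Real.mul_self_sqrt (hg i).le, mul_inv_cancel₀ (hg i).ne']
      linear_combination X.det * h2
    rw [← h1, Real.log_mul hY.det_pos.ne' hDp.det_pos.ne']
    ring
  have hXtr : X.trace ≤ Y.trace := by
    rw [hYtr]
    refine Finset.sum_le_sum fun i _ => ?_
    exact le_mul_of_one_le_left hX.diag_pos.le (one_le_gramMean hn i)
  set m := ν.real Set.univ with hm
  set c := ν.real s with hc
  set e := ∫ x in sᶜ, ((triMat x)ᵀ * triMat x).trace ∂ν with hedef
  have hiG : Integrable (fun x => ((triMat x)ᵀ * triMat x).trace) ν := integrable_trace_gram n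
  have htrX : (m - e) * Y.trace ≤ ∫ x in s, (triMat x * X * (triMat x)ᵀ).trace ∂ν := by
    have h1 := integral_add_compl hs (integrable_trace_conj n X)
    rw [integral_trace_conj hn, ← hYtr] at h1
    have h2 : ∫ x in sᶜ, (triMat x * X * (triMat x)ᵀ).trace ∂ν ≤ X.trace * e := by
      rw [hedef, ← integral_const_mul]
      exact integral_mono (integrable_trace_conj n X).integrableOn
        (hiG.integrableOn.const_mul _) fun x => trace_conj_le hX.posSemidef _
    have h3 : 0 ≤ e := integral_nonneg fun x => by
      simpa using (Matrix.posSemidef_conjTranspose_mul_self (triMat x)).trace_nonneg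
    have h4 := mul_le_mul_of_nonneg_right hXtr h3
    rw [sub_mul]
    linarith
  have htrD : ∫ x in s, (triMat x * D * (triMat x)ᵀ).trace ∂ν ≤ p * m := by
    calc _ ≤ ∫ x, (triMat x * D * (triMat x)ᵀ).trace ∂ν := by
          refine setIntegral_le_integral (integrable_trace_conj n D)
            (Filter.Eventually.of_forall fun x => ?_)
          simpa using (hDp.posSemidef.mul_mul_conjTranspose_same (triMat x)).trace_nonneg
      _ = p * m := by
          rw [integral_trace_conj hn, mul_comm]
          congr 1
          rw [Finset.sum_congr rfl fun i _ => show gramMean p n i * D i i = 1 by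
            rw [hD, Matrix.diagonal_apply_eq, mul_inv_cancel₀ (hg i).ne']]
          simp
  have hdiff : ∫ x in s, steinLoss p (triMat x * X * (triMat x)ᵀ) ∂ν -
      ∫ x in s, steinLoss p (triMat x * D * (triMat x)ᵀ) ∂ν =
      ∫ x in s, (triMat x * X * (triMat x)ᵀ).trace ∂ν -
        ∫ x in s, (triMat x * D * (triMat x)ᵀ).trace ∂ν - c * Real.log Y.det := by
    have hiX : IntegrableOn (fun x => (triMat x * X * (triMat x)ᵀ).trace) s ν :=
      (integrable_trace_conj n X).integrableOn
    have hiD : IntegrableOn (fun x => (triMat x * D * (triMat x)ᵀ).trace) s ν :=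
      (integrable_trace_conj n D).integrableOn
    have hiXD : IntegrableOn (fun x => (triMat x * X * (triMat x)ᵀ).trace -
      (triMat x * D * (triMat x)ᵀ).trace) s ν := hiX.sub hiD
    have hconst : ∫ _ in s, Real.log Y.det ∂ν = c * Real.log Y.det := by
      rw [setIntegral_const, smul_eq_mul]
    rw [← integral_sub (integrable_steinLoss hs hst hlog hX)
      (integrable_steinLoss hs hst hlog hDp), ← integral_sub hiX hiD, ← hconst,
      ← integral_sub hiXD (integrable_const _)]
    refine setIntegral_congr_fun hs fun x hx => ?_
    have hx' := memTplus_triMat_iff.2 (hst hx)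
    simp only [steinLoss_conj hX hx', steinLoss_conj hDp hx', hYdet]
    ring
  have hkey := mul_trace_sub_mul_log_det_ge hY (sub_pos.2 he) hpos
  simp only [jamesStein_eq, truncationError]
  rw [mul_sub]
  linarith

lemma setLIntegral_steinLoss_ge {n : ℕ} (hn : p ≤ n) {s : Set (TriCoords p)}
    (hs : MeasurableSet s) (hst : s ⊆ triPos p)
    (hlog : IntegrableOn (fun x => Real.log (triMat x).det) s (wishartMeasure p n))
    (hpos : 0 < (wishartMeasure p n).real s)
    (he : ∫ x in sᶜ, ((triMat x)ᵀ * triMat x).trace ∂(wishartMeasure p n) <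
      (wishartMeasure p n).real Set.univ)
    {X : Matrix (Fin p) (Fin p) ℝ} (hX : X.PosDef) :
    ∫⁻ x in s, ENNReal.ofReal (steinLoss p (jamesStein p n (triMat x))) ∂(wishartMeasure p n) ≤
      ∫⁻ x in s, ENNReal.ofReal (steinLoss p (triMat x * X * (triMat x)ᵀ))
          ∂(wishartMeasure p n) + ENNReal.ofReal (truncationError p n s) := by
  have hnn : ∀ {X : Matrix (Fin p) (Fin p) ℝ}, X.PosDef →
      0 ≤ᵐ[(wishartMeasure p n).restrict s]
        fun x => steinLoss p (triMat x * X * (triMat x)ᵀ) := fun hX =>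
    (ae_restrict_iff' hs).2 (Filter.Eventually.of_forall fun x hx =>
      steinLoss_nonneg (posDef_conj hX (memTplus_triMat_iff.2 (hst hx)).isUnit_det))
  have hDp := posDef_diagonal_gramMean_inv hn
  have h := setIntegral_steinLoss_ge hn hs hst hlog hpos he hX
  simp only [jamesStein_eq] at h ⊢
  rw [← ofReal_integral_eq_lintegral_ofReal (integrable_steinLoss hs hst hlog hX) (hnn hX),
    ← ofReal_integral_eq_lintegral_ofReal (integrable_steinLoss hs hst hlog hDp) (hnn hDp)]
  exact (ENNReal.ofReal_le_ofReal h).trans ENNReal.ofReal_add_le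

end BayesBound

section Averaging

variable {p : ℕ}

lemma setOf_abs_le_eq_Icc {ι : Type*} (r : ι → ℝ) :
    {y : ι → ℝ | ∀ q, |y q| ≤ r q} = Set.Icc (-r) r := by
  ext y
  simp only [Set.mem_ofPred_eq, abs_le, Set.mem_Icc, Pi.le_def, Pi.neg_apply, forall_and]

lemma volume_scaled_box {ι : Type*} [Fintype ι] {θ : ℝ} (hθ : 0 < θ) (r : ι → ℝ) :
    volume {y : ι → ℝ | ∀ q, |y q| ≤ θ * r q} =
      ENNReal.ofReal (θ ^ Fintype.card ι) * volume {y : ι → ℝ | ∀ q, |y q| ≤ r q} := by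
  rw [setOf_abs_le_eq_Icc, setOf_abs_le_eq_Icc, Real.volume_Icc_pi, Real.volume_Icc_pi,
    ENNReal.ofReal_pow hθ.le, ← Finset.card_univ, ← Finset.prod_const, ← Finset.prod_mul_distrib]
  refine Finset.prod_congr rfl fun q _ => ?_
  rw [← ENNReal.ofReal_mul hθ.le]
  congr 1
  simp only [Pi.neg_apply]
  ring

/-- The lower triangular matrices whose inverses satisfy uniform bounds. -/
def truncSet (p : ℕ) (b : ℝ) : Set (TriCoords p) :=
  {x | x ∈ triPos p ∧ (∀ i j, |(triMat x)⁻¹ i j| ≤ b) ∧ ∀ i, b⁻¹ ≤ (triMat x)⁻¹ i i}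

lemma truncSet_subset_triPos (b : ℝ) : truncSet p b ⊆ triPos p := fun _ hx => hx.1

lemma measurableSet_truncSet (b : ℝ) : MeasurableSet (truncSet p b) := by
  have h : ∀ i j, Measurable fun x : TriCoords p => (triMat x)⁻¹ i j :=
    measurable_matrix_iff.1 (measurable_matrix_inv.comp measurable_triMat)
  have h1 : MeasurableSet {x : TriCoords p | ∀ i j, |(triMat x)⁻¹ i j| ≤ b} := by
    simp only [Set.ofPred_forall]
    exact MeasurableSet.iInter fun i => MeasurableSet.iInter fun j =>
      measurableSet_le (h i j).abs measurable_const
  have h2 : MeasurableSet {x : TriCoords p | ∀ i, b⁻¹ ≤ (triMat x)⁻¹ i i} := by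
    simp only [Set.ofPred_forall]
    exact MeasurableSet.iInter fun i => measurableSet_le measurable_const (h i i)
  exact measurableSet_triPos.inter (h1.inter h2)

lemma truncSet_mono {a b : ℝ} (ha : 0 < a) (hab : a ≤ b) : truncSet p a ⊆ truncSet p b :=
  fun _ hx => ⟨hx.1, fun i j => (hx.2.1 i j).trans hab,
    fun i => (inv_anti₀ ha hab).trans (hx.2.2 i)⟩

lemma iUnion_truncSet : ⋃ N : ℕ, truncSet p ((N : ℝ) + 1) = triPos p := by
  refine Set.Subset.antisymm (Set.iUnion_subset fun N => truncSet_subset_triPos _) fun x hx => ?_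
  have hT := (memTplus_triMat_iff.2 hx).inv
  obtain ⟨N, hN⟩ := exists_nat_ge (∑ i, ∑ j, |(triMat x)⁻¹ i j| + ∑ i, ((triMat x)⁻¹ i i)⁻¹)
  have hpos : ∀ i, 0 < ((triMat x)⁻¹ i i)⁻¹ := fun i => inv_pos.2 (hT.2 i)
  have h1 : 0 ≤ ∑ i, ((triMat x)⁻¹ i i)⁻¹ := Finset.sum_nonneg fun i _ => (hpos i).le
  have h2 : 0 ≤ ∑ i, ∑ j, |(triMat x)⁻¹ i j| :=
    Finset.sum_nonneg fun i _ => Finset.sum_nonneg fun j _ => abs_nonneg _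
  refine Set.mem_iUnion.2 ⟨N, hx, fun i j => ?_, fun i => ?_⟩
  · have h3 : |(triMat x)⁻¹ i j| ≤ ∑ j, |(triMat x)⁻¹ i j| :=
      Finset.single_le_sum (f := fun j => |(triMat x)⁻¹ i j|)
        (fun j _ => abs_nonneg _) (Finset.mem_univ j)
    have h4 : ∑ j, |(triMat x)⁻¹ i j| ≤ ∑ i, ∑ j, |(triMat x)⁻¹ i j| :=
      Finset.single_le_sum (f := fun i => ∑ j, |(triMat x)⁻¹ i j|)
        (fun i _ => Finset.sum_nonneg fun j _ => abs_nonneg _) (Finset.mem_univ i)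
    linarith
  · have h3 : ((triMat x)⁻¹ i i)⁻¹ ≤ ∑ i, ((triMat x)⁻¹ i i)⁻¹ :=
      Finset.single_le_sum (f := fun i => ((triMat x)⁻¹ i i)⁻¹)
        (fun i _ => (hpos i).le) (Finset.mem_univ i)
    exact inv_le_of_inv_le₀ (hT.2 i) (by linarith)

lemma integrableOn_log_det_truncSet (n : ℕ) {b : ℝ} (hb : 1 ≤ b) :
    IntegrableOn (fun x => Real.log (triMat x).det) (truncSet p b) (wishartMeasure p n) := by
  have hm : Measurable fun x : TriCoords p => Real.log (triMat x).det :=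
    Real.measurable_log.comp (measurable_matrix_det.comp measurable_triMat)
  refine Measure.integrableOn_of_bounded (M := p * Real.log b) (measure_ne_top _ _)
    hm.aestronglyMeasurable ((ae_restrict_iff' (measurableSet_truncSet b)).2
      (Filter.Eventually.of_forall fun x hx => ?_))
  have hT := memTplus_triMat_iff.2 hx.1
  have hb0 : 0 < b := one_pos.trans_le hb
  rw [hT.det_eq, Real.log_prod fun i _ => (hT.2 i).ne']
  calc ‖∑ i, Real.log (triMat x i i)‖ ≤ ∑ i, ‖Real.log (triMat x i i)‖ := norm_sum_le _ _
    _ ≤ ∑ _i : Fin p, Real.log b := Finset.sum_le_sum fun i _ => ?_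
    _ = p * Real.log b := by
        rw [Finset.sum_const, Finset.card_univ, Fintype.card_fin, nsmul_eq_mul]
  have h1 : (triMat x i i)⁻¹ ≤ b := by
    rw [← hT.inv_diag]
    exact (le_abs_self _).trans (hx.2.1 i i)
  have h2 : b⁻¹ ≤ (triMat x i i)⁻¹ := by
    rw [← hT.inv_diag]
    exact hx.2.2 i
  rw [Real.norm_eq_abs, abs_le, ← Real.log_inv]
  have h3 : b⁻¹ ≤ triMat x i i := inv_le_of_inv_le₀ (hT.2 i) h1
  have h4 : triMat x i i ≤ b := (inv_le_inv₀ hb0 (hT.2 i)).1 h2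
  exact ⟨Real.log_le_log (inv_pos.2 hb0) h3, Real.log_le_log (hT.2 i) h4⟩

/-- The loss of `δ` at the observation `t`, when `t = g * w` and the parameter is `g⁻¹`. -/
noncomputable def pivotLoss (δ : Matrix (Fin p) (Fin p) ℝ → Matrix (Fin p) (Fin p) ℝ)
    (w t : Matrix (Fin p) (Fin p) ℝ) : ℝ≥0∞ :=
  ENNReal.ofReal (steinLoss p (w * (t⁻¹ * δ t * (t⁻¹)ᵀ) * wᵀ))

lemma measurable_pivotLoss {δ : Matrix (Fin p) (Fin p) ℝ → Matrix (Fin p) (Fin p) ℝ}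
    (hδ : Measurable δ) {α : Type*} [MeasurableSpace α] {f g : α → Matrix (Fin p) (Fin p) ℝ}
    (hf : Measurable f) (hg : Measurable g) : Measurable fun a => pivotLoss δ (f a) (g a) := by
  have hi := measurable_matrix_inv.comp hg
  exact ENNReal.measurable_ofReal.comp (measurable_steinLoss.comp
    ((hf.mul ((hi.mul (hδ.comp hg)).mul (measurable_matrix_transpose.comp hi))).mul
      (measurable_matrix_transpose.comp hf)))

lemma pivotLoss_mul (δ : Matrix (Fin p) (Fin p) ℝ → Matrix (Fin p) (Fin p) ℝ)
    (g : Matrix (Fin p) (Fin p) ℝ) {w : Matrix (Fin p) (Fin p) ℝ} (hw : IsUnit w.det) :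
    pivotLoss δ w (g * w) = ENNReal.ofReal (steinLoss p (g⁻¹ * δ (g * w) * (g⁻¹)ᵀ)) := by
  have h : g⁻¹ = w * (g * w)⁻¹ := by
    rw [Matrix.mul_inv_rev, ← Matrix.mul_assoc, Matrix.mul_nonsing_inv _ hw, Matrix.one_mul]
  rw [pivotLoss]
  conv_rhs => rw [h, Matrix.transpose_mul]
  simp only [Matrix.mul_assoc]

/-- Averaging the risk over an almost invariant box of parameters. -/
lemma averaged_risk_le {n : ℕ} {b θ : ℝ} (hb : 1 ≤ b) (h0 : 0 < θ) (h1 : θ < 1)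
    {δ : Matrix (Fin p) (Fin p) ℝ → Matrix (Fin p) (Fin p) ℝ} (hδ : Measurable δ)
    {S L E : ℝ≥0∞}
    (hS : ∀ g : Matrix (Fin p) (Fin p) ℝ, memTplus g →
      ∫⁻ x, pivotLoss δ (triMat x) (g * triMat x) ∂(wishartMeasure p n) ≤ S)
    (hL : ∀ t : Matrix (Fin p) (Fin p) ℝ, memTplus t →
      L ≤ ∫⁻ x in truncSet p b, pivotLoss δ (triMat x) t ∂(wishartMeasure p n) + E) :
    ENNReal.ofReal (θ ^ Fintype.card (LowIdx p)) * L ≤ S + E := by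
  obtain ⟨r, hr0, hr⟩ := exists_almost_invariant_box p hb h0 h1
  set K : Set (TriCoords p) := {y | ∀ q, |y q| ≤ r q} with hK
  set K' : Set (TriCoords p) := {y | ∀ q, |y q| ≤ θ * r q} with hK'
  set ν := wishartMeasure p n
  have hvol : volume K' = ENNReal.ofReal (θ ^ Fintype.card (LowIdx p)) * volume K :=
    volume_scaled_box h0 r
  have hvK : volume K = ∏ q, ENNReal.ofReal (r q - -r q) := by
    rw [hK, setOf_abs_le_eq_Icc, Real.volume_Icc_pi]
    rfl
  have hK0 : volume K ≠ 0 := by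
    rw [hvK]
    refine Finset.prod_ne_zero_iff.2 fun q _ => ?_
    rw [Ne, ENNReal.ofReal_eq_zero, not_le]
    linarith [hr0 q]
  have hKtop : volume K ≠ ∞ := by
    rw [hvK]
    exact ENNReal.prod_ne_top fun q _ => ENNReal.ofReal_ne_top
  have hK'K : volume K' ≤ volume K := measure_mono fun y hy q =>
    (hy q).trans (mul_le_of_le_one_left (hr0 q).le h1.le)
  have hm1 : Measurable fun z : TriCoords p × TriCoords p =>
      pivotLoss δ (triMat z.2) (expMat z.1) :=
    measurable_pivotLoss hδ (measurable_triMat.comp measurable_snd)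
      (measurable_expMat.comp measurable_fst)
  have hm2 : Measurable fun z : TriCoords p × TriCoords p =>
      pivotLoss δ (triMat z.2) (expMat z.1 * triMat z.2) :=
    measurable_pivotLoss hδ (measurable_triMat.comp measurable_snd)
      ((measurable_expMat.comp measurable_fst).mul (measurable_triMat.comp measurable_snd))
  have hmain : L * volume K' ≤ (S + E) * volume K := by
    calc L * volume K' = ∫⁻ _ in K', L := (setLIntegral_const _ _).symm
      _ ≤ ∫⁻ y in K', (∫⁻ x in truncSet p b, pivotLoss δ (triMat x) (expMat y) ∂ν + E) :=
          lintegral_mono fun y => hL _ (memTplus_expMat y)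
      _ = ∫⁻ x in truncSet p b, (∫⁻ y in K', pivotLoss δ (triMat x) (expMat y)) ∂ν +
            E * volume K' := by
          rw [lintegral_add_right _ measurable_const, setLIntegral_const,
            lintegral_lintegral_swap hm1.aemeasurable]
      _ ≤ ∫⁻ x in truncSet p b,
            (∫⁻ y in K, pivotLoss δ (triMat x) (expMat y * triMat x)) ∂ν + E * volume K := by
          refine add_le_add (setLIntegral_mono' (measurableSet_truncSet b) fun x hx => ?_)
            (mul_le_mul_right hK'K _)
          have hT := memTplus_triMat_iff.2 hx.1
          exact lintegral_box_le hT (hr _ hT.inv hx.2.1 hx.2.2)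
            (measurable_pivotLoss hδ measurable_const measurable_expMat)
      _ ≤ ∫⁻ x, (∫⁻ y in K, pivotLoss δ (triMat x) (expMat y * triMat x)) ∂ν +
            E * volume K := add_le_add (setLIntegral_le_lintegral _ _) le_rfl
      _ = (∫⁻ y in K, ∫⁻ x, pivotLoss δ (triMat x) (expMat y * triMat x) ∂ν) +
            E * volume K := by
          rw [← lintegral_lintegral_swap hm2.aemeasurable]
      _ ≤ (∫⁻ _ in K, S) + E * volume K :=
          add_le_add (lintegral_mono fun y => hS _ (memTplus_expMat y)) le_rfl
      _ = (S + E) * volume K := by rw [setLIntegral_const, add_mul]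
  rw [hvol, ← mul_assoc, mul_comm L] at hmain
  exact (ENNReal.mul_le_mul_iff_left hK0 hKtop).1 hmain

lemma le_of_forall_ofReal_pow_mul_le {k : ℕ} {a c : ℝ≥0∞}
    (h : ∀ θ : ℝ, 0 < θ → θ < 1 → ENNReal.ofReal (θ ^ k) * a ≤ c) : a ≤ c := by
  have h1 : Filter.Tendsto (fun θ : ℝ => ENNReal.ofReal (θ ^ k) * a) (nhdsWithin 1 (Set.Iio 1))
      (nhds (ENNReal.ofReal (1 ^ k) * a)) := by
    refine ENNReal.Tendsto.mul_const (ENNReal.tendsto_ofReal ?_) (Or.inl (by simp))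
    exact ((continuous_pow k).tendsto 1).mono_left nhdsWithin_le_nhds
  rw [one_pow, ENNReal.ofReal_one, one_mul] at h1
  refine le_of_tendsto h1 ?_
  filter_upwards [Ioo_mem_nhdsLT (zero_lt_one' ℝ)] with θ hθ using h θ hθ.1 hθ.2

lemma tendsto_integral_compl_truncSet (n : ℕ) {f : TriCoords p → ℝ}
    (hf : Integrable f (wishartMeasure p n)) :
    Filter.Tendsto (fun N : ℕ => ∫ x in (truncSet p ((N : ℝ) + 1))ᶜ, f x ∂(wishartMeasure p n))
      Filter.atTop (nhds 0) := by
  have h := tendsto_setIntegral_of_antitone (μ := wishartMeasure p n) (f := f)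
    (s := fun N : ℕ => (truncSet p ((N : ℝ) + 1))ᶜ)
    (fun N => (measurableSet_truncSet _).compl)
    (fun M N hMN => Set.compl_subset_compl.2 (truncSet_mono (by positivity)
      (by simpa using hMN))) ⟨0, hf.integrableOn⟩
  rwa [← Set.compl_iUnion, iUnion_truncSet, setIntegral_measure_zero] at h
  exact ae_iff.1 (ae_mem_triPos p n)

lemma tendsto_measureReal_truncSet (p n : ℕ) :
    Filter.Tendsto (fun N : ℕ => (wishartMeasure p n).real (truncSet p ((N : ℝ) + 1)))
      Filter.atTop (nhds ((wishartMeasure p n).real Set.univ)) := by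
  have h := (tendsto_integral_compl_truncSet n
    (integrable_const (μ := wishartMeasure p n) (1 : ℝ))).const_sub
      ((wishartMeasure p n).real Set.univ)
  rw [sub_zero] at h
  refine h.congr fun N => ?_
  rw [setIntegral_const, smul_eq_mul, mul_one, measureReal_compl (measurableSet_truncSet _)]
  ring

lemma tendsto_truncationError (p n : ℕ) :
    Filter.Tendsto (fun N : ℕ => truncationError p n (truncSet p ((N : ℝ) + 1)))
      Filter.atTop (nhds 0) := by
  have hm := wishartMeasure_real_univ_pos p n
  have hc := tendsto_measureReal_truncSet p n
  have he := tendsto_integral_compl_truncSet n (integrable_trace_gram (p := p) n)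
  have h1 := (hc.mul (hc.log hm.ne'))
  have h2 := he.const_sub ((wishartMeasure p n).real Set.univ)
  rw [sub_zero] at h2
  have h3 := (((hc.sub h1).add (hc.mul (h2.log hm.ne'))).const_sub
    ((wishartMeasure p n).real Set.univ)).const_mul (p : ℝ)
  refine (h3.congr fun N => rfl).trans (le_of_eq ?_)
  congr 1
  ring

lemma lintegral_jamesStein_le {n : ℕ} (hn : p ≤ n)
    {δ : Matrix (Fin p) (Fin p) ℝ → Matrix (Fin p) (Fin p) ℝ} (hδ : Measurable δ)
    (hpd : ∀ T, memTplus T → (δ T).PosDef) {S : ℝ≥0∞}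
    (hS : ∀ g : Matrix (Fin p) (Fin p) ℝ, memTplus g →
      ∫⁻ x, pivotLoss δ (triMat x) (g * triMat x) ∂(wishartMeasure p n) ≤ S) :
    ∫⁻ x, ENNReal.ofReal (steinLoss p (jamesStein p n (triMat x))) ∂(wishartMeasure p n) ≤ S := by
  set ν := wishartMeasure p n with hν
  have hm : Measurable fun x : TriCoords p =>
      ENNReal.ofReal (steinLoss p (jamesStein p n (triMat x))) :=
    ENNReal.measurable_ofReal.comp (measurable_steinLoss.comp
      ((measurable_triMat.mul_const _).mul (measurable_matrix_transpose.comp measurable_triMat)))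
  have hmono : Monotone fun N : ℕ => truncSet p ((N : ℝ) + 1) := fun M N hMN =>
    truncSet_mono (by positivity) (by simpa using hMN)
  have hlim : Filter.Tendsto (fun N : ℕ => ∫⁻ x in truncSet p ((N : ℝ) + 1),
      ENNReal.ofReal (steinLoss p (jamesStein p n (triMat x))) ∂ν) Filter.atTop
      (nhds (∫⁻ x, ENNReal.ofReal (steinLoss p (jamesStein p n (triMat x))) ∂ν)) := by
    have h := tendsto_measure_iUnion_atTop (μ := ν.withDensity fun x =>
      ENNReal.ofReal (steinLoss p (jamesStein p n (triMat x)))) hmono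
    rw [iUnion_truncSet, withDensity_apply _ measurableSet_triPos,
      Measure.restrict_eq_self_of_ae_mem (ae_mem_triPos p n)] at h
    exact h.congr fun N => withDensity_apply _ (measurableSet_truncSet _)
  have herr : Filter.Tendsto (fun N : ℕ =>
      S + ENNReal.ofReal (truncationError p n (truncSet p ((N : ℝ) + 1)))) Filter.atTop
      (nhds S) := by
    have h := (ENNReal.tendsto_ofReal (tendsto_truncationError p n)).const_add S
    rwa [ENNReal.ofReal_zero, add_zero] at h
  refine le_of_tendsto_of_tendsto hlim herr ?_
  have hmpos := wishartMeasure_real_univ_pos p n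
  filter_upwards [(tendsto_measureReal_truncSet p n).eventually (lt_mem_nhds hmpos),
    (tendsto_integral_compl_truncSet n (integrable_trace_gram (p := p) n)).eventually
      (gt_mem_nhds hmpos)] with N hpos he
  have hb : (1 : ℝ) ≤ (N : ℝ) + 1 := by simp
  refine le_of_forall_ofReal_pow_mul_le fun θ h0 h1 => averaged_risk_le hb h0 h1 hδ hS fun t ht => ?_
  exact setLIntegral_steinLoss_ge hn (measurableSet_truncSet _) (truncSet_subset_triPos _)
    (integrableOn_log_det_truncSet n hb) hpos he (posDef_conj (hpd t ht) ht.inv.isUnit_det)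

end Averaging

/-- (Theorem 3.3) The James–Stein estimator is minimax under Stein loss: its risk is
constant, equal to `R₀`, and every measurable positive-definite-valued estimator has
supremum risk at least `R₀`. -/
theorem james_stein_minimax
    (p n : ℕ) (hp : 1 ≤ p) (hn : p ≤ n)
    (R₀ : ℝ≥0∞)
    (hR₀ : R₀ = ∫⁻ x in triPos p,
      ENNReal.ofReal (steinLoss p (jamesStein p n (triMat x)) *
        (wishartDens p n 1 (triMat x) * gammaDensR x))) :
    (∀ Θ : Matrix (Fin p) (Fin p) ℝ, memTplus Θ →
      ∫⁻ x in triPos p,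
        ENNReal.ofReal (steinLoss p (Θ * jamesStein p n (triMat x) * Θᵀ) *
          (wishartDens p n Θ (triMat x) * gammaDensR x)) = R₀) ∧
    (∀ δ : Matrix (Fin p) (Fin p) ℝ → Matrix (Fin p) (Fin p) ℝ, Measurable δ →
      (∀ T, memTplus T → (δ T).PosDef) →
      R₀ ≤ ⨆ (Θ : Matrix (Fin p) (Fin p) ℝ) (_ : memTplus Θ),
        ∫⁻ x in triPos p,
          ENNReal.ofReal (steinLoss p (Θ * δ (triMat x) * Θᵀ) *
            (wishartDens p n Θ (triMat x) * gammaDensR x))) := by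
  refine ⟨fun Θ hΘ => by rw [hR₀, risk_jamesStein n hΘ], fun δ hδ hpd => ?_⟩
  rw [hR₀, lintegral_wishartDens hn]
  set C := ENNReal.ofReal (wishartC p n)⁻¹ with hC
  have hC0 : C ≠ 0 := (ENNReal.ofReal_pos.2 (inv_pos.2 (wishartC_pos hn))).ne'
  rw [mul_comm, ← ENNReal.le_div_iff_mul_le (Or.inl hC0) (Or.inl ENNReal.ofReal_ne_top)]
  refine lintegral_jamesStein_le hn hδ hpd fun g hg => ?_
  rw [ENNReal.le_div_iff_mul_le (Or.inl hC0) (Or.inl ENNReal.ofReal_ne_top), mul_comm]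
  refine le_trans (le_of_eq ?_) (le_iSup₂ g⁻¹ hg.inv)
  rw [risk_inv n hg, lintegral_wishartDens hn, hC]
  congr 1
  refine lintegral_congr_ae ?_
  filter_upwards [ae_mem_triPos p n] with x hx
  exact pivotLoss_mul δ g (memTplus_triMat_iff.2 hx).isUnit_det
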